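/- arXiv:2106.09425 — 7 statements merged into one kernel-verified Lean document; each statement's English description precedes it below -/
import Mathlib

section
/- Fix n ≥ 2. Consider the group P presented with one generator ⟨σ⟩ for every permutation σ of Fin n, and with relating words (as elements of FreeGroup (Equiv.Perm (Fin n))): of(b)⁻¹ · of(a) · of(b) · of(b⁻¹·a·b)⁻¹ for all permutations a, b, and of(a) · of(b) · of(a·b)⁻¹ for all permutations a, b with N(a·b) = N(a) + N(b). Then there is a group isomorphism from P onto the subgroup H = {(r, σ) ∈ ℤ × Equiv.Perm (Fin n) : (−1)^r = sign σ} of the product group ℤ × Equiv.Perm (Fin n), sending the class of the generator ⟨σ⟩ to (N(σ), σ). (Equivalently: the enveloping group of the geodesic PMQ S_n^geo is the index‑2 subgroup of ℤ × S_n of pairs (r, σ) with r of the same parity as σ.) -/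
/-- Word-length norm of a permutation with respect to the set of all transpositions:
the least `m` such that `σ` is a product of `m` transpositions. -/
noncomputable def permNorm {n : ℕ} (σ : Equiv.Perm (Fin n)) : ℕ :=
  sInf {m | ∃ l : List (Equiv.Perm (Fin n)), (∀ τ ∈ l, τ.IsSwap) ∧ l.prod = σ ∧ l.length = m}

/-- The relating words of the enveloping group of the geodesic PMQ `S_n^geo`:
conjugation relations for all pairs of permutations, and product relations for all
geodesic pairs (pairs whose norms add up). -/
noncomputable def hurRels (n : ℕ) : Set (FreeGroup (Equiv.Perm (Fin n))) :=
  {r | ∃ a b : Equiv.Perm (Fin n),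
      r = (FreeGroup.of b)⁻¹ * FreeGroup.of a * FreeGroup.of b *
        (FreeGroup.of (b⁻¹ * a * b))⁻¹} ∪
  {r | ∃ a b : Equiv.Perm (Fin n),
      permNorm (a * b) = permNorm a + permNorm b ∧
      r = FreeGroup.of a * FreeGroup.of b * (FreeGroup.of (a * b))⁻¹}

/-- The subgroup of `ℤ × S_n` of pairs `(r, σ)` with `(-1)^r = sign σ`. -/
def paritySubgroup (n : ℕ) : Subgroup (Multiplicative ℤ × Equiv.Perm (Fin n)) where
  carrier := {p | (-1 : ℤˣ) ^ (Multiplicative.toAdd p.1) = Equiv.Perm.sign p.2}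
  one_mem' := by simp
  mul_mem' := by
    intro a b ha hb
    simp only [Set.mem_setOf_eq, Prod.fst_mul, Prod.snd_mul, toAdd_mul, zpow_add, map_mul] at *
    rw [ha, hb]
  inv_mem' := by
    intro a ha
    simp only [Set.mem_setOf_eq, Prod.fst_inv, Prod.snd_inv, toAdd_inv, zpow_neg, map_inv] at *
    rw [ha]

section PermNorm

variable {n : ℕ}

theorem exists_minimal_swap_list (σ : Equiv.Perm (Fin n)) :
    ∃ l : List (Equiv.Perm (Fin n)),
      (∀ τ ∈ l, τ.IsSwap) ∧ l.prod = σ ∧ l.length = permNorm σ := by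
  have h : {m | ∃ l : List (Equiv.Perm (Fin n)),
      (∀ τ ∈ l, τ.IsSwap) ∧ l.prod = σ ∧ l.length = m}.Nonempty := by
    obtain ⟨l, hl, hs⟩ := (Equiv.Perm.truncSwapFactors σ).out
    exact ⟨l.length, l, hs, hl, rfl⟩
  exact Nat.sInf_mem h

theorem permNorm_prod_le {l : List (Equiv.Perm (Fin n))} (hl : ∀ τ ∈ l, τ.IsSwap) :
    permNorm l.prod ≤ l.length :=
  Nat.sInf_le ⟨l, hl, rfl, rfl⟩

theorem permNorm_one : permNorm (1 : Equiv.Perm (Fin n)) = 0 := by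
  simpa using permNorm_prod_le (n := n) (l := []) (by simp)

theorem sign_eq_neg_one_pow_permNorm (σ : Equiv.Perm (Fin n)) :
    Equiv.Perm.sign σ = (-1) ^ permNorm σ := by
  obtain ⟨l, hs, rfl, hl⟩ := exists_minimal_swap_list σ
  rw [← hl, Equiv.Perm.sign_prod_list_swap hs]

theorem permNorm_swap_mul_le {t : Equiv.Perm (Fin n)} (ht : t.IsSwap)
    (σ : Equiv.Perm (Fin n)) : permNorm (t * σ) ≤ permNorm σ + 1 := by
  obtain ⟨l, hs, rfl, hl⟩ := exists_minimal_swap_list σ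
  rw [← hl]
  simpa using permNorm_prod_le (l := t :: l) (by simpa using ⟨ht, hs⟩)

theorem Equiv.Perm.IsSwap.mul_self_eq_one {t : Equiv.Perm (Fin n)} (ht : t.IsSwap) :
    t * t = 1 := by
  obtain ⟨x, y, -, rfl⟩ := ht
  exact Equiv.swap_mul_self x y

theorem permNorm_swap_mul_s0 {t : Equiv.Perm (Fin n)} (ht : t.IsSwap) (σ : Equiv.Perm (Fin n)) :
    permNorm (t * σ) = permNorm σ + 1 ∨ permNorm σ = permNorm (t * σ) + 1 := by
  have h₁ := permNorm_swap_mul_le ht σ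
  have h₂ := permNorm_swap_mul_le ht (t * σ)
  rw [← mul_assoc, ht.mul_self_eq_one, one_mul] at h₂
  have h₃ : permNorm (t * σ) ≠ permNorm σ := by
    intro h
    have hsign : Equiv.Perm.sign (t * σ) = Equiv.Perm.sign σ := by
      rw [sign_eq_neg_one_pow_permNorm, sign_eq_neg_one_pow_permNorm, h]
    simp [ht.sign_eq] at hsign
  omega

theorem permNorm_eq_one_of_isSwap {t : Equiv.Perm (Fin n)} (ht : t.IsSwap) :
    permNorm t = 1 := by
  simpa [permNorm_one] using permNorm_swap_mul_s0 ht 1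

/-- Induction on permutations along geodesics in the Cayley graph of the transpositions. -/
theorem permNorm_induction {p : Equiv.Perm (Fin n) → Prop} (one : p 1)
    (swap_mul : ∀ t ρ, t.IsSwap → permNorm (t * ρ) = permNorm ρ + 1 → p ρ → p (t * ρ))
    (σ : Equiv.Perm (Fin n)) : p σ := by
  obtain ⟨l, hs, rfl, hl⟩ := exists_minimal_swap_list σ
  induction l with
  | nil => simpa using one
  | cons t l ih =>
    have hs' : ∀ τ ∈ l, τ.IsSwap := fun τ hτ => hs τ (List.mem_cons_of_mem _ hτ)
    have ht : t.IsSwap := hs t List.mem_cons_self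
    have h₁ := permNorm_prod_le hs'
    have h₂ := permNorm_swap_mul_le ht l.prod
    rw [List.prod_cons, List.length_cons] at hl
    rw [List.prod_cons]
    exact swap_mul t l.prod ht (by omega) (ih hs' (by omega))

theorem Equiv.Perm.IsSwap.conj {t : Equiv.Perm (Fin n)} (ht : t.IsSwap)
    (b : Equiv.Perm (Fin n)) : (b⁻¹ * t * b).IsSwap := by
  obtain ⟨x, y, hxy, rfl⟩ := ht
  refine ⟨b⁻¹ x, b⁻¹ y, by simpa using hxy, ?_⟩
  rw [Equiv.swap_apply_apply, inv_inv]

theorem permNorm_conj_le (a b : Equiv.Perm (Fin n)) :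
    permNorm (b⁻¹ * a * b) ≤ permNorm a := by
  induction a using permNorm_induction with
  | one => simp [permNorm_one]
  | swap_mul t ρ ht h ih =>
    have := permNorm_swap_mul_le (ht.conj b) (b⁻¹ * ρ * b)
    rw [show b⁻¹ * t * b * (b⁻¹ * ρ * b) = b⁻¹ * (t * ρ) * b by group] at this
    omega

theorem permNorm_conj (a b : Equiv.Perm (Fin n)) :
    permNorm (b⁻¹ * a * b) = permNorm a := by
  refine (permNorm_conj_le a b).antisymm ?_
  have := permNorm_conj_le (b⁻¹ * a * b) b⁻¹
  rwa [show b⁻¹⁻¹ * (b⁻¹ * a * b) * b⁻¹ = a by group] at this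

end PermNorm

section EnvelopingGroup

variable {n : ℕ}

/-- The class of the generator `⟨σ⟩` in the enveloping group. -/
def envelopingOf (σ : Equiv.Perm (Fin n)) : PresentedGroup (hurRels n) :=
  PresentedGroup.of σ

theorem envelopingOf_conj (a b : Equiv.Perm (Fin n)) :
    (envelopingOf b)⁻¹ * envelopingOf a * envelopingOf b = envelopingOf (b⁻¹ * a * b) :=
  mul_inv_eq_one.1 (PresentedGroup.one_of_mem (rels := hurRels n) (Or.inl ⟨a, b, rfl⟩))

theorem envelopingOf_mul {a b : Equiv.Perm (Fin n)}
    (h : permNorm (a * b) = permNorm a + permNorm b) :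
    envelopingOf a * envelopingOf b = envelopingOf (a * b) :=
  mul_inv_eq_one.1 (PresentedGroup.one_of_mem (rels := hurRels n) (Or.inr ⟨a, b, h, rfl⟩))

theorem envelopingOf_one : envelopingOf (1 : Equiv.Perm (Fin n)) = 1 := by
  have h := envelopingOf_mul (a := (1 : Equiv.Perm (Fin n))) (b := 1) (by simp [permNorm_one])
  rwa [mul_one, mul_eq_left] at h

theorem envelopingOf_swap_mul {t ρ : Equiv.Perm (Fin n)} (ht : t.IsSwap)
    (h : permNorm (t * ρ) = permNorm ρ + 1) :
    envelopingOf t * envelopingOf ρ = envelopingOf (t * ρ) :=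
  envelopingOf_mul (by rw [h, permNorm_eq_one_of_isSwap ht, add_comm])

theorem envelopingOf_swap_sq_mem_center {t : Equiv.Perm (Fin n)} (ht : t.IsSwap) :
    envelopingOf t ^ 2 ∈ Subgroup.center (PresentedGroup (hurRels n)) := by
  rw [Subgroup.mem_center_iff]
  intro p
  have hgen : Subgroup.closure (Set.range (PresentedGroup.of (rels := hurRels n))) ≤
      Subgroup.centralizer {envelopingOf t ^ 2} := by
    rw [Subgroup.closure_le]
    rintro _ ⟨a, rfl⟩
    change envelopingOf a ∈ _
    rw [SetLike.mem_coe, Subgroup.mem_centralizer_singleton_iff]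
    have h₁ := envelopingOf_conj a t
    have h₂ := envelopingOf_conj (t⁻¹ * a * t) t
    rw [← h₁] at h₂
    have htt : t⁻¹ = t := inv_eq_of_mul_eq_one_left ht.mul_self_eq_one
    have h₃ : t⁻¹ * (t⁻¹ * a * t) * t = a := by
      rw [htt, show t * (t * a * t) * t = (t * t) * a * (t * t) by group, ht.mul_self_eq_one,
        one_mul, mul_one]
    rw [h₃] at h₂
    nth_rewrite 2 [← h₂]
    simp only [pow_two, mul_assoc, mul_inv_cancel_left]
  rw [PresentedGroup.closure_range_of] at hgen
  exact Subgroup.mem_centralizer_singleton_iff.1 (hgen (Subgroup.mem_top p))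

theorem envelopingOf_swap_sq_eq {s t : Equiv.Perm (Fin n)} (hs : s.IsSwap) (ht : t.IsSwap) :
    envelopingOf s ^ 2 = envelopingOf t ^ 2 := by
  obtain ⟨b, hb⟩ : ∃ b, b⁻¹ * t * b = s := by
    obtain ⟨w, x, hwx, rfl⟩ := ht
    obtain ⟨y, z, hyz, rfl⟩ := hs
    obtain ⟨c, hc⟩ := isConj_iff.1 (Equiv.Perm.isConj_swap hwx hyz)
    exact ⟨c⁻¹, by rw [inv_inv, hc]⟩
  have hc := Subgroup.mem_center_iff.1 (envelopingOf_swap_sq_mem_center ht) (envelopingOf b)⁻¹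
  rw [← hb, ← envelopingOf_conj]
  calc ((envelopingOf b)⁻¹ * envelopingOf t * envelopingOf b) ^ 2
      = (envelopingOf b)⁻¹ * envelopingOf t ^ 2 * envelopingOf b := by
        simp only [pow_two]; group
    _ = envelopingOf t ^ 2 := by rw [hc, inv_mul_cancel_right]

/-- Every element of the enveloping group is a product of a power of the central element
`⟨t⟩ ^ 2` and a generator. -/
theorem exists_eq_zpow_mul_envelopingOf {t : Equiv.Perm (Fin n)} (ht : t.IsSwap)
    (p : PresentedGroup (hurRels n)) :
    ∃ (k : ℤ) (σ : Equiv.Perm (Fin n)), p = (envelopingOf t ^ 2) ^ k * envelopingOf σ := by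
  have hcomm : ∀ (k : ℤ) (x : PresentedGroup (hurRels n)),
      x * (envelopingOf t ^ 2) ^ k = (envelopingOf t ^ 2) ^ k * x := fun k =>
    Subgroup.mem_center_iff.1 (Subgroup.zpow_mem _ (envelopingOf_swap_sq_mem_center ht) k)
  have hswap : ∀ (s σ : Equiv.Perm (Fin n)), s.IsSwap → ∃ k : ℤ,
      envelopingOf s * envelopingOf σ = (envelopingOf t ^ 2) ^ k * envelopingOf (s * σ) := by
    intro s σ hs
    rcases permNorm_swap_mul_s0 hs σ with h | h
    · exact ⟨0, by rw [envelopingOf_swap_mul hs h, zpow_zero, one_mul]⟩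
    · refine ⟨1, ?_⟩
      have hσ : s * (s * σ) = σ := by rw [← mul_assoc, hs.mul_self_eq_one, one_mul]
      have h' := envelopingOf_swap_mul (ρ := s * σ) hs (by rw [hσ, h])
      rw [hσ] at h'
      rw [← h', zpow_one, ← envelopingOf_swap_sq_eq hs ht, pow_two, mul_assoc]
  have hgen : ∀ τ σ : Equiv.Perm (Fin n), ∃ k : ℤ,
      envelopingOf τ * envelopingOf σ = (envelopingOf t ^ 2) ^ k * envelopingOf (τ * σ) := by
    intro τ σ
    induction τ using permNorm_induction with
    | one => exact ⟨0, by simp [envelopingOf_one]⟩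
    | swap_mul s ρ hs h ih =>
      obtain ⟨k, hk⟩ := ih
      obtain ⟨m, hm⟩ := hswap s (ρ * σ) hs
      refine ⟨k + m, ?_⟩
      rw [← envelopingOf_swap_mul hs h, mul_assoc, hk, ← mul_assoc, hcomm, mul_assoc, hm,
        ← mul_assoc, ← zpow_add, mul_assoc s]
  have hmul : ∀ p q : PresentedGroup (hurRels n),
      (∃ (k : ℤ) (σ : Equiv.Perm (Fin n)), p = (envelopingOf t ^ 2) ^ k * envelopingOf σ) →
      (∃ (k : ℤ) (σ : Equiv.Perm (Fin n)), q = (envelopingOf t ^ 2) ^ k * envelopingOf σ) →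
      ∃ (k : ℤ) (σ : Equiv.Perm (Fin n)), p * q = (envelopingOf t ^ 2) ^ k * envelopingOf σ := by
    rintro _ _ ⟨k, σ, rfl⟩ ⟨m, τ, rfl⟩
    obtain ⟨j, hj⟩ := hgen σ τ
    refine ⟨k + m + j, σ * τ, ?_⟩
    rw [mul_assoc, ← mul_assoc (envelopingOf σ), hcomm, mul_assoc, hj, ← mul_assoc, ← mul_assoc,
      ← zpow_add, ← zpow_add]
  have hinv : ∀ σ : Equiv.Perm (Fin n), ∃ (k : ℤ) (τ : Equiv.Perm (Fin n)),
      (envelopingOf σ)⁻¹ = (envelopingOf t ^ 2) ^ k * envelopingOf τ := by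
    intro σ
    obtain ⟨k, hk⟩ := hgen σ⁻¹ σ
    refine ⟨-k, σ⁻¹, ?_⟩
    rw [inv_mul_cancel, envelopingOf_one, mul_one] at hk
    rw [zpow_neg, ← hk]
    group
  induction p using PresentedGroup.induction_on with
  | _ w =>
    induction w using FreeGroup.induction_on with
    | C1 => exact ⟨0, 1, by simp [envelopingOf_one]⟩
    | of σ => exact ⟨0, σ, by rw [zpow_zero, one_mul]; rfl⟩
    | inv_of σ _ => simpa [envelopingOf, PresentedGroup.of] using hinv σ
    | mul x y hx hy => simpa using hmul _ _ hx hy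

/-- The element `(N(σ), σ)` of the parity subgroup. -/
noncomputable def normPair (σ : Equiv.Perm (Fin n)) : paritySubgroup n :=
  ⟨(Multiplicative.ofAdd (permNorm σ : ℤ), σ), by
    change (-1 : ℤˣ) ^ (permNorm σ : ℤ) = Equiv.Perm.sign σ
    rw [sign_eq_neg_one_pow_permNorm, zpow_natCast]⟩

theorem lift_normPair_eq_one (r : FreeGroup (Equiv.Perm (Fin n))) (hr : r ∈ hurRels n) :
    FreeGroup.lift normPair r = 1 := by
  rcases hr with ⟨a, b, rfl⟩ | ⟨a, b, h, rfl⟩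
  · simp only [map_mul, map_inv, FreeGroup.lift_apply_of]
    rw [mul_inv_eq_one]
    refine Subtype.ext (Prod.ext ?_ rfl)
    simp [normPair, permNorm_conj]
  · simp only [map_mul, map_inv, FreeGroup.lift_apply_of]
    rw [mul_inv_eq_one]
    refine Subtype.ext (Prod.ext ?_ rfl)
    simp [normPair, h]

/-- The homomorphism from the enveloping group sending `⟨σ⟩` to `(N(σ), σ)`. -/
noncomputable def envelopingHom (n : ℕ) : PresentedGroup (hurRels n) →* paritySubgroup n :=
  PresentedGroup.toGroup lift_normPair_eq_one

theorem envelopingHom_of (σ : Equiv.Perm (Fin n)) :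
    envelopingHom n (envelopingOf σ) = normPair σ :=
  PresentedGroup.toGroup.of _

theorem coe_envelopingHom_zpow_mul {t : Equiv.Perm (Fin n)} (ht : t.IsSwap) (k : ℤ)
    (σ : Equiv.Perm (Fin n)) :
    (envelopingHom n ((envelopingOf t ^ 2) ^ k * envelopingOf σ) :
      Multiplicative ℤ × Equiv.Perm (Fin n)) =
        (Multiplicative.ofAdd (2 * k + permNorm σ : ℤ), σ) := by
  have hz : ((normPair t ^ 2 : paritySubgroup n) : Multiplicative ℤ × Equiv.Perm (Fin n)) =
      (Multiplicative.ofAdd 2, 1) := by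
    refine Prod.ext ?_ ?_
    · simp only [normPair, permNorm_eq_one_of_isSwap ht]; rfl
    · simpa [normPair, pow_two] using ht.mul_self_eq_one
  rw [map_mul, map_zpow, map_pow, envelopingHom_of, envelopingHom_of, Subgroup.coe_mul,
    Subgroup.coe_zpow, hz]
  refine Prod.ext ?_ ?_
  · simp [normPair, ← ofAdd_zsmul, ofAdd_add, mul_comm]
  · simp [normPair]

theorem envelopingHom_bijective (hn : 2 ≤ n) : Function.Bijective (envelopingHom n) := by
  obtain ⟨t, ht⟩ : ∃ t : Equiv.Perm (Fin n), t.IsSwap :=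
    ⟨_, ⟨0, by omega⟩, ⟨1, by omega⟩, by simp, rfl⟩
  constructor
  · rw [injective_iff_map_eq_one]
    intro p hp
    obtain ⟨k, σ, rfl⟩ := exists_eq_zpow_mul_envelopingOf ht p
    have h := coe_envelopingHom_zpow_mul ht k σ
    rw [hp, Subgroup.coe_one, Prod.ext_iff] at h
    obtain ⟨h₁, h₂⟩ := h
    obtain rfl : 1 = σ := h₂
    have h₃ : (0 : ℤ) = 2 * k + permNorm (1 : Equiv.Perm (Fin n)) :=
      congrArg Multiplicative.toAdd h₁
    rw [permNorm_one] at h₃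
    obtain rfl : k = 0 := by omega
    rw [zpow_zero, envelopingOf_one, one_mul]
  · rintro ⟨⟨r, σ⟩, h⟩
    change (-1 : ℤˣ) ^ r.toAdd = Equiv.Perm.sign σ at h
    have heven : Even (r.toAdd - permNorm σ) := by
      rw [← Int.negOnePow_eq_one_iff, Int.negOnePow_def, zpow_sub, h,
        sign_eq_neg_one_pow_permNorm, zpow_natCast, mul_inv_cancel]
    obtain ⟨k, hk⟩ := heven
    refine ⟨(envelopingOf t ^ 2) ^ k * envelopingOf σ, Subtype.ext ?_⟩
    rw [coe_envelopingHom_zpow_mul ht]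
    refine Prod.ext ?_ rfl
    change 2 * k + (permNorm σ : ℤ) = r.toAdd
    omega

end EnvelopingGroup

/-- The enveloping group of the geodesic PMQ `S_n^geo` is isomorphic to the index-2
subgroup of `ℤ × S_n` of pairs `(r, σ)` with `r` of the same parity as `σ`, via
`⟨σ⟩ ↦ (N(σ), σ)`. -/
theorem envelopingGroup_of_geodesic_symmetric_group (n : ℕ) (hn : 2 ≤ n) :
    ∃ e : PresentedGroup (hurRels n) ≃* paritySubgroup n,
      ∀ σ : Equiv.Perm (Fin n),
        (e (PresentedGroup.of σ) : Multiplicative ℤ × Equiv.Perm (Fin n)) =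
          (Multiplicative.ofAdd (permNorm σ : ℤ), σ) :=
  ⟨MulEquiv.ofBijective (envelopingHom n) (envelopingHom_bijective hn), fun σ =>
    congrArg Subtype.val (envelopingHom_of σ)⟩
end

section
/- Let l and l′ be lists of transpositions of Fin n. Then l and l′ are connected by standard moves if and only if all of the following hold: (i) l.prod = l′.prod; (ii) the subgroup G generated by the entries of l equals the subgroup generated by the entries of l′; (iii) for every x : Fin n, the number of entries τ of l (counted with multiplicity) whose support is contained in the G-orbit of x equals the corresponding number of entries of l′. (This classifies the elements of the completion of the geodesic PMQ S_n^geo: they correspond to triples consisting of a permutation σ, a partition of {1,…,n} into blocks preserved by σ, and a count of transpositions per block, subject to the natural constraints.) -/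
open scoped Classical

/-- A single standard move on a list of elements of a group: an adjacent pair `(a, b)`
is replaced by `(b, b⁻¹ * a * b)` or by `(a * b * a⁻¹, a)`. -/
def StandardMove {G : Type*} [Group G] (l l' : List G) : Prop :=
  ∃ (l₁ l₂ : List G) (a b : G),
    l = l₁ ++ a :: b :: l₂ ∧
    (l' = l₁ ++ b :: (b⁻¹ * a * b) :: l₂ ∨ l' = l₁ ++ (a * b * a⁻¹) :: a :: l₂)

/-- Two lists are connected by standard moves. -/
def StdConnected {G : Type*} [Group G] : List G → List G → Prop :=
  Relation.ReflTransGen StandardMove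

section Group

variable {G : Type*} [Group G]

theorem StandardMove.symm {l l' : List G} (h : StandardMove l l') : StandardMove l' l := by
  obtain ⟨p, q, a, b, rfl, rfl | rfl⟩ := h
  · exact ⟨p, q, _, _, rfl, Or.inr (by simp [mul_assoc])⟩
  · exact ⟨p, q, _, _, rfl, Or.inl (by simp [mul_assoc])⟩

theorem StandardMove.append {l l' : List G} (h : StandardMove l l') (p q : List G) :
    StandardMove (p ++ l ++ q) (p ++ l' ++ q) := by
  obtain ⟨p', q', a, b, rfl, rfl | rfl⟩ := h
  · exact ⟨p ++ p', q' ++ q, a, b, by simp, Or.inl (by simp)⟩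
  · exact ⟨p ++ p', q' ++ q, a, b, by simp, Or.inr (by simp)⟩

namespace StdConnected

theorem refl (l : List G) : StdConnected l l := Relation.ReflTransGen.refl

theorem trans {l₁ l₂ l₃ : List G} (h : StdConnected l₁ l₂) (h' : StdConnected l₂ l₃) :
    StdConnected l₁ l₃ := Relation.ReflTransGen.trans h h'

theorem symm {l l' : List G} (h : StdConnected l l') : StdConnected l' l := by
  induction h with
  | refl => exact refl _
  | tail _ h ih => exact Relation.ReflTransGen.head h.symm ih

theorem of_eq {l l' : List G} (h : l = l') : StdConnected l l' := h ▸ refl l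

theorem append {l l' m m' : List G} (h : StdConnected l l') (h' : StdConnected m m') :
    StdConnected (l ++ m) (l' ++ m') := by
  have h₁ : StdConnected (l ++ m) (l' ++ m) := by
    induction h with
    | refl => exact refl _
    | tail _ h ih => exact ih.tail (by simpa using h.append [] m)
  have h₂ : StdConnected (l' ++ m) (l' ++ m') := by
    induction h' with
    | refl => exact refl _
    | tail _ h ih => exact ih.tail (by simpa using h.append l' [])
  exact h₁.trans h₂

theorem append_left (p : List G) {l l' : List G} (h : StdConnected l l') :
    StdConnected (p ++ l) (p ++ l') := (refl p).append h

theorem append_right {l l' : List G} (h : StdConnected l l') (q : List G) :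
    StdConnected (l ++ q) (l' ++ q) := h.append (refl q)

theorem cons (a : G) {l l' : List G} (h : StdConnected l l') :
    StdConnected (a :: l) (a :: l') := append_left [a] h

theorem swap_right (a b : G) (l : List G) :
    StdConnected (a :: b :: l) (b :: (b⁻¹ * a * b) :: l) :=
  Relation.ReflTransGen.single ⟨[], l, a, b, rfl, Or.inl rfl⟩

theorem swap_left (a b : G) (l : List G) :
    StdConnected (a :: b :: l) ((a * b * a⁻¹) :: a :: l) :=
  Relation.ReflTransGen.single ⟨[], l, a, b, rfl, Or.inr rfl⟩

theorem cons_append_singleton (a : G) (l : List G) :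
    StdConnected (a :: l) (l ++ [l.prod⁻¹ * a * l.prod]) := by
  induction l generalizing a with
  | nil => exact of_eq (by simp)
  | cons b l ih =>
    exact (swap_right a b l).trans
      (((ih (b⁻¹ * a * b)).cons b).trans (of_eq (by simp [mul_assoc])))

theorem pair_append {a : G} (ha : a * a = 1) (l : List G) :
    StdConnected (a :: a :: l) (l ++ [a, a]) := by
  have ha' : a⁻¹ = a := inv_eq_of_mul_eq_one_left ha
  induction l with
  | nil => exact refl _
  | cons b l ih =>
    refine ((swap_left a b l).cons a).trans ((swap_left a _ _).trans ?_)
    have : a * (a * b * a⁻¹) * a⁻¹ = b := by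
      rw [ha', ← mul_assoc, ← mul_assoc, ha, one_mul, mul_assoc, ha, mul_one]
    rw [this]
    exact ih.cons b

theorem pair_conj_of_mem {a b : G} (ha : a * a = 1) {l : List G} (hb : b ∈ l) :
    StdConnected (a :: a :: l) ((b⁻¹ * a * b) :: (b⁻¹ * a * b) :: l) := by
  obtain ⟨p, q, rfl⟩ := List.append_of_mem hb
  have ha' : (b⁻¹ * a * b) * (b⁻¹ * a * b) = 1 := by
    rw [show (b⁻¹ * a * b) * (b⁻¹ * a * b) = b⁻¹ * (a * a) * b by group, ha]; group
  have h₁ : ∀ {c : G}, c * c = 1 → ∀ q,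
      StdConnected (c :: c :: (p ++ q)) (p ++ c :: c :: q) := fun {c} hc q => by
    simpa using (pair_append hc p).append_right q
  refine (h₁ ha _).trans (StdConnected.trans ?_ (h₁ ha' _).symm)
  refine append_left p (((swap_right a b q).cons a).trans ((swap_right a b _).trans ?_))
  simpa using (pair_append ha' [b]).symm.append_right q

theorem pair_conj {a g : G} (ha : a * a = 1) {l : List G}
    (hg : g ∈ Subgroup.closure {b | b ∈ l}) :
    StdConnected (a :: a :: l) ((g⁻¹ * a * g) :: (g⁻¹ * a * g) :: l) := by
  have hconj : ∀ {a : G}, a * a = 1 → ∀ g, (g⁻¹ * a * g) * (g⁻¹ * a * g) = 1 := fun {a} ha g => by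
    rw [show (g⁻¹ * a * g) * (g⁻¹ * a * g) = g⁻¹ * (a * a) * g by group, ha]; group
  induction hg using Subgroup.closure_induction generalizing a with
  | mem b hb => exact pair_conj_of_mem ha hb
  | one => exact of_eq (by simp)
  | mul x y _ _ hx hy =>
    refine (hx ha).trans ((hy (hconj ha x)).trans (of_eq ?_))
    simp [mul_assoc]
  | inv x _ hx =>
    refine ((hx (hconj ha x⁻¹)).trans (of_eq ?_)).symm
    simp [mul_assoc]

theorem length_eq {l l' : List G} (h : StdConnected l l') : l.length = l'.length := by
  induction h with
  | refl => rfl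
  | tail _ h ih =>
    obtain ⟨p, q, a, b, rfl, rfl | rfl⟩ := h <;> simpa using ih

theorem prod_eq {l l' : List G} (h : StdConnected l l') : l.prod = l'.prod := by
  induction h with
  | refl => rfl
  | tail _ h ih =>
    obtain ⟨p, q, a, b, rfl, rfl | rfl⟩ := h <;> simp [ih, mul_assoc]

end StdConnected

theorem StandardMove.closure_le {l l' : List G} (h : StandardMove l l') :
    Subgroup.closure {a | a ∈ l'} ≤ Subgroup.closure {a | a ∈ l} := by
  rw [Subgroup.closure_le]
  obtain ⟨p, q, a, b, rfl, h⟩ := h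
  have hmem : ∀ c ∈ p ++ a :: b :: q, c ∈ Subgroup.closure {a' | a' ∈ p ++ a :: b :: q} :=
    fun c hc => Subgroup.subset_closure hc
  have ha := hmem a (by simp)
  have hb := hmem b (by simp)
  intro c hc
  obtain rfl | rfl := h
  · simp only [Set.mem_ofPred_eq, List.mem_append, List.mem_cons] at hc
    obtain hc | rfl | rfl | hc := hc
    · exact hmem c (by simp [hc])
    · exact hb
    · exact mul_mem (mul_mem (inv_mem hb) ha) hb
    · exact hmem c (by simp [hc])
  · simp only [Set.mem_ofPred_eq, List.mem_append, List.mem_cons] at hc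
    obtain hc | rfl | rfl | hc := hc
    · exact hmem c (by simp [hc])
    · exact mul_mem (mul_mem ha hb) (inv_mem ha)
    · exact ha
    · exact hmem c (by simp [hc])

theorem StdConnected.closure_eq {l l' : List G} (h : StdConnected l l') :
    Subgroup.closure {a | a ∈ l} = Subgroup.closure {a | a ∈ l'} := by
  induction h with
  | refl => rfl
  | tail _ h ih => exact ih.trans (le_antisymm h.symm.closure_le h.closure_le)

theorem StdConnected.countP_eq {l l' : List G} (h : StdConnected l l') (p : G → Bool)
    (hp : ∀ g ∈ Subgroup.closure {a | a ∈ l}, ∀ a, p (g * a * g⁻¹) = p a) :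
    l.countP p = l'.countP p := by
  induction h with
  | refl => rfl
  | tail h' h ih =>
    rw [ih]
    rw [StdConnected.closure_eq h'] at hp
    obtain ⟨l₁, l₂, a, b, rfl, h⟩ := h
    have ha := hp a (Subgroup.subset_closure (by simp)) b
    have hb := hp b⁻¹ (inv_mem (Subgroup.subset_closure (by simp))) a
    rw [inv_inv] at hb
    obtain rfl | rfl := h
    · simp [List.countP_append, List.countP_cons, hb]; ring
    · simp [List.countP_append, List.countP_cons, ha]; ring

end Group

section Perm

open Equiv

theorem Equiv.Perm.apply_eq_of_mem_closure {α : Type*} {S : Set (Perm α)} {x : α}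
    (hS : ∀ τ ∈ S, τ x = x) {g : Perm α} (hg : g ∈ Subgroup.closure S) : g x = x := by
  have : Subgroup.closure S ≤ MulAction.stabilizer (Perm α) x := by
    rw [Subgroup.closure_le]
    exact fun τ hτ => hS τ hτ
  exact this hg

variable {α : Type*} [DecidableEq α]

/-- All entries of `m` are transpositions fixing `n`. -/
def FixingSwaps (n : α) (m : List (Perm α)) : Prop := ∀ τ ∈ m, τ.IsSwap ∧ τ n = n

theorem FixingSwaps.append {n : α} {m m' : List (Perm α)} (h : FixingSwaps n m)
    (h' : FixingSwaps n m') : FixingSwaps n (m ++ m') := by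
  intro τ hτ
  rcases List.mem_append.1 hτ with hτ | hτ
  exacts [h τ hτ, h' τ hτ]

theorem FixingSwaps.cons {n : α} {m : List (Perm α)} (h : FixingSwaps n m) {τ : Perm α}
    (hτ : τ.IsSwap) (hn : τ n = n) : FixingSwaps n (τ :: m) := by
  intro τ' hτ'
  rcases List.mem_cons.1 hτ' with rfl | hτ'
  exacts [⟨hτ, hn⟩, h τ' hτ']

theorem FixingSwaps.isSwap_append_replicate {n a : α} (ha : a ≠ n) {m : List (Perm α)}
    (h : FixingSwaps n m) (k : ℕ) : ∀ τ ∈ m ++ List.replicate k (swap n a), τ.IsSwap := by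
  intro τ hτ
  rcases List.mem_append.1 hτ with hτ | hτ
  · exact (h τ hτ).1
  · rw [List.eq_of_mem_replicate hτ]
    exact ⟨n, a, ha.symm, rfl⟩

theorem FixingSwaps.apply_eq {n : α} {m : List (Perm α)} (h : FixingSwaps n m) {g : Perm α}
    (hg : g ∈ Subgroup.closure {τ | τ ∈ m}) : g n = n :=
  Perm.apply_eq_of_mem_closure (fun τ hτ => (h τ hτ).2) hg

theorem FixingSwaps.prod_apply {n : α} {m : List (Perm α)} (h : FixingSwaps n m) :
    m.prod n = n :=
  h.apply_eq (Subgroup.list_prod_mem _ fun _ hτ => Subgroup.subset_closure hτ)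

theorem exists_stdConnected_cons_replicate {n a b : α} (ha : a ≠ n) (hb : b ≠ n) (k : ℕ) :
    ∃ (m : List (Perm α)) (c : α) (j : ℕ), c ≠ n ∧ FixingSwaps n m ∧
      StdConnected (swap n b :: List.replicate k (swap n a))
        (m ++ List.replicate j (swap n c)) := by
  induction k with
  | zero => exact ⟨[], b, 1, hb, by simp [FixingSwaps], StdConnected.refl _⟩
  | succ k ih =>
    by_cases hab : b = a
    · subst hab
      exact ⟨[], b, k + 2, hb, by simp [FixingSwaps], StdConnected.refl _⟩
    · obtain ⟨m, c, j, hc, hm, h⟩ := ih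
      refine ⟨swap b a :: m, c, j, hc, hm.cons ⟨b, a, hab, rfl⟩
        (swap_apply_of_ne_of_ne hb.symm ha.symm), ?_⟩
      refine (StdConnected.swap_left _ _ _).trans ?_
      rw [← swap_apply_apply, swap_apply_left, swap_apply_of_ne_of_ne ha (Ne.symm hab)]
      exact h.cons _

theorem exists_stdConnected_append_replicate {n : α} (hn : ∃ a, a ≠ n) {l : List (Perm α)}
    (hl : ∀ τ ∈ l, τ.IsSwap) :
    ∃ (m : List (Perm α)) (a : α) (k : ℕ), a ≠ n ∧ FixingSwaps n m ∧
      StdConnected l (m ++ List.replicate k (swap n a)) := by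
  induction l with
  | nil =>
    obtain ⟨a, ha⟩ := hn
    exact ⟨[], a, 0, ha, by simp [FixingSwaps], StdConnected.refl _⟩
  | cons τ l ih =>
    obtain ⟨m, a, k, ha, hm, h⟩ := ih fun τ hτ => hl τ (List.mem_cons_of_mem _ hτ)
    have hτ := hl τ List.mem_cons_self
    by_cases hτn : τ n = n
    · exact ⟨τ :: m, a, k, ha, hm.cons hτ hτn, h.cons τ⟩
    obtain ⟨b, hb, hτb⟩ : ∃ b, b ≠ n ∧ τ = swap n b := by
      obtain ⟨x, y, hxy, rfl⟩ := hτ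
      rcases (swap_apply_ne_self_iff.1 hτn).2 with rfl | rfl
      exacts [⟨y, hxy.symm, rfl⟩, ⟨x, hxy, swap_comm _ _⟩]
    have hmn : m.prod⁻¹ n = n := by rw [Perm.inv_eq_iff_eq, hm.prod_apply]
    have hconj : m.prod⁻¹ * τ * m.prod = swap n (m.prod⁻¹ b) := by
      conv_rhs => rw [← hmn]
      rw [swap_apply_apply, inv_inv, hτb]
    have hb' : m.prod⁻¹ b ≠ n := fun h => hb (by rw [← hmn] at h; exact m.prod⁻¹.injective h)
    obtain ⟨m', c, j, hc, hm', h'⟩ := exists_stdConnected_cons_replicate ha hb' k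
    refine ⟨m ++ m', c, j, hc, hm.append hm', (h.cons τ).trans ?_⟩
    have := (StdConnected.cons_append_singleton τ m).append_right (List.replicate k (swap n a))
    rw [hconj] at this
    refine this.trans ?_
    simpa using h'.append_left m

theorem StdConnected.append_replicate_add_two (m : List (Perm α)) (x y : α) (k : ℕ) :
    StdConnected (m ++ List.replicate (k + 2) (swap x y))
      (swap x y :: swap x y :: (m ++ List.replicate k (swap x y))) := by
  refine (StdConnected.trans (pair_append (swap_mul_self x y) _) (of_eq ?_)).symm
  rw [List.replicate_add, List.append_assoc]
  rfl

theorem exists_stdConnected_reduced {n a : α} (ha : a ≠ n) {m : List (Perm α)}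
    (hm : FixingSwaps n m) (k : ℕ) :
    ∃ (m' : List (Perm α)) (a' : α) (k' : ℕ), a' ≠ n ∧ FixingSwaps n m' ∧
      (k' ≤ 2 ∨ ∀ τ ∈ m', τ a' = a') ∧
      StdConnected (m ++ List.replicate k (swap n a))
        (m' ++ List.replicate k' (swap n a')) := by
  induction k using Nat.strong_induction_on generalizing m with
  | _ k ih =>
    by_cases hk : k ≤ 2 ∨ ∀ τ ∈ m, τ a = a
    · exact ⟨m, a, k, ha, hm, hk, StdConnected.refl _⟩
    push Not at hk
    obtain ⟨hk, τ, hτm, hτa⟩ := hk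
    obtain ⟨j, rfl⟩ : ∃ j, k = j + 2 := ⟨k - 2, by omega⟩
    obtain ⟨hτ, hτn⟩ := hm τ hτm
    obtain ⟨b, hba, rfl⟩ : ∃ b, b ≠ a ∧ τ = swap a b := by
      obtain ⟨x, y, hxy, rfl⟩ := hτ
      rcases (swap_apply_ne_self_iff.1 hτa).2 with rfl | rfl
      exacts [⟨y, hxy.symm, rfl⟩, ⟨x, hxy, swap_comm _ _⟩]
    have hbn : b ≠ n := by
      rintro rfl
      rw [swap_apply_right] at hτn
      exact ha hτn
    obtain ⟨m', a', k', ha', hm', hk', h⟩ := @ih j (by omega)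
      (swap b a :: swap b a :: m)
      ((hm.cons ⟨b, a, hba, rfl⟩ (swap_apply_of_ne_of_ne hbn.symm ha.symm)).cons
        ⟨b, a, hba, rfl⟩ (swap_apply_of_ne_of_ne hbn.symm ha.symm))
    refine ⟨m', a', k', ha', hm', hk', StdConnected.trans ?_ h⟩
    refine (StdConnected.append_replicate_add_two m n a j).trans ?_
    have hmem : swap n b ∈ Subgroup.closure {τ | τ ∈ m ++ List.replicate j (swap n a)} := by
      refine SubmonoidClass.swap_mem_trans _ (b := a) (Subgroup.subset_closure ?_)
        (Subgroup.subset_closure ?_)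
      · simp [show j ≠ 0 by omega]
      · simp [hτm]
    have := StdConnected.pair_conj (swap_mul_self n a) hmem
    rwa [show (swap n b)⁻¹ * swap n a * swap n b = swap b a by
      have := swap_apply_apply (swap n b) n a
      rw [swap_apply_left, swap_apply_of_ne_of_ne ha hba.symm] at this
      rw [this, swap_inv]] at this

theorem swap_mem_closure_of_append_replicate {n a : α} (ha : a ≠ n) {m : List (Perm α)}
    (hm : FixingSwaps n m) {k : ℕ} {x y : α} (hx : x ≠ n) (hy : y ≠ n)
    (h : swap x y ∈ Subgroup.closure {τ | τ ∈ m ++ List.replicate k (swap n a)}) :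
    swap x y ∈ Subgroup.closure {τ | τ ∈ m} := by
  set H := Subgroup.closure {τ | τ ∈ m} with hH
  let φ : α → α := fun z => if z = n then a else z
  have key : ∀ g ∈ Subgroup.closure {τ | τ ∈ m ++ List.replicate k (swap n a)},
      ∀ z, φ (g z) ∈ MulAction.orbit H (φ z) := by
    intro g hg
    induction hg using Subgroup.closure_induction with
    | mem τ hτ =>
      intro z
      rcases List.mem_append.1 hτ with hτ | hτ
      · have hτn := (hm τ hτ).2
        by_cases hz : z = n
        · rw [hz, hτn]
          exact MulAction.mem_orbit_self _
        · have hτz : τ z ≠ n := fun h => hz (τ.injective (h.trans hτn.symm))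
          simp only [φ, hz, hτz, if_false]
          exact ⟨⟨τ, Subgroup.subset_closure hτ⟩, rfl⟩
      · rw [List.eq_of_mem_replicate hτ]
        have : φ (swap n a z) = φ z := by
          simp only [φ, swap_apply_def]
          split_ifs <;> simp_all
        rw [this]
        exact MulAction.mem_orbit_self _
    | one => exact fun z => MulAction.mem_orbit_self _
    | mul g g' _ _ hg hg' =>
      intro z
      have := hg (g' z)
      rwa [MulAction.orbit_eq_iff.2 (hg' z)] at this
    | inv g _ hg =>
      intro z
      have := hg (g⁻¹ z)
      rw [show g (g⁻¹ z) = z from g.apply_symm_apply z] at this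
      exact MulAction.mem_orbit_symm.1 this
  have := key _ h y
  rw [swap_apply_right] at this
  simp only [φ, hx, hy, if_false] at this
  exact (swap_mem_closure_isSwap fun τ hτ => (hm τ hτ).1).2 this

theorem orbit_closure_eq_swap_mem {l : List (Perm α)} (hl : ∀ τ ∈ l, τ.IsSwap) (y : α) :
    MulAction.orbit (Subgroup.closure {τ | τ ∈ l}) y =
      {x | swap x y ∈ Subgroup.closure {τ | τ ∈ l}} :=
  Set.ext fun _ => (swap_mem_closure_isSwap hl).symm

theorem FixingSwaps.append_replicate_prod_inv_apply {n a : α} {m : List (Perm α)}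
    (hm : FixingSwaps n m) (k : ℕ) :
    (m ++ List.replicate k (swap n a)).prod⁻¹ n = if Even k then n else a := by
  have hmn : m.prod⁻¹ n = n := by rw [Perm.inv_eq_iff_eq, hm.prod_apply]
  rw [List.prod_append, List.prod_replicate, mul_inv_rev, Perm.mul_apply, hmn, ← inv_pow, swap_inv]
  split_ifs with hk
  · obtain ⟨j, rfl⟩ := hk
    rw [← two_mul, pow_mul, pow_two, swap_mul_self, one_pow, Perm.one_apply]
  · obtain ⟨j, rfl⟩ := Nat.not_even_iff_odd.1 hk
    rw [pow_succ, pow_mul, pow_two, swap_mul_self, one_pow, one_mul, swap_apply_left]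

theorem swap_mem_closure_append_replicate {n a : α} {m : List (Perm α)} {k : ℕ} (hk : k ≠ 0) :
    swap n a ∈ Subgroup.closure {τ | τ ∈ m ++ List.replicate k (swap n a)} :=
  Subgroup.subset_closure (by simp [hk])

theorem FixingSwaps.ne_zero_of_swap_mem_closure {n a b : α} (hb : b ≠ n) {m : List (Perm α)}
    (hm : FixingSwaps n m) {k : ℕ}
    (h : swap n b ∈ Subgroup.closure {τ | τ ∈ m ++ List.replicate k (swap n a)}) : k ≠ 0 := by
  rintro rfl
  rw [List.replicate_zero, List.append_nil] at h
  have := hm.apply_eq h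
  rw [swap_apply_left] at this
  exact hb this

theorem StdConnected.of_append_replicate_two {n a a' : α} (ha : a ≠ n) (ha' : a' ≠ n)
    {m : List (Perm α)} (hm : FixingSwaps n m)
    (h : swap n a ∈ Subgroup.closure {τ | τ ∈ m ++ List.replicate 2 (swap n a')}) :
    StdConnected (m ++ List.replicate 2 (swap n a')) (m ++ List.replicate 2 (swap n a)) := by
  have hmem : swap a a' ∈ Subgroup.closure {τ | τ ∈ m} := by
    refine swap_mem_closure_of_append_replicate ha' hm (k := 2) ha ha' ?_
    refine SubmonoidClass.swap_mem_trans _ (b := n) (by rwa [swap_comm a]) ?_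
    exact swap_mem_closure_append_replicate two_ne_zero
  have := StdConnected.pair_conj (swap_mul_self n a') hmem
  rw [show (swap a a')⁻¹ * swap n a' * swap a a' = swap n a by
    have := swap_apply_apply (swap a a') n a'
    rw [swap_apply_right, swap_apply_of_ne_of_ne ha.symm ha'.symm] at this
    rw [this, swap_inv]] at this
  refine (append_replicate_add_two m n a' 0).trans
    (StdConnected.trans ?_ (append_replicate_add_two m n a 0).symm)
  simpa using this

variable [Fintype α]

/-- The number of entries of `l` whose support is contained in `S`. -/
noncomputable def supportCount (l : List (Perm α)) (S : Set α) : ℕ :=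
  l.countP fun τ => decide ((↑τ.support : Set α) ⊆ S)

theorem supportCount_append (l l' : List (Perm α)) (S : Set α) :
    supportCount (l ++ l') S = supportCount l S + supportCount l' S :=
  List.countP_append

theorem supportCount_congr {l : List (Perm α)} {S S' : Set α}
    (h : ∀ τ ∈ l, (↑τ.support : Set α) ⊆ S ↔ (↑τ.support : Set α) ⊆ S') :
    supportCount l S = supportCount l S' :=
  List.countP_congr fun τ hτ => by simpa using h τ hτ

theorem supportCount_eq_zero {l : List (Perm α)} (hl : ∀ τ ∈ l, τ.IsSwap) {S : Set α}
    (hS : ∀ τ ∈ l, ((↑τ.support : Set α) ∩ S).Subsingleton) : supportCount l S = 0 := by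
  refine List.countP_eq_zero.2 fun τ hτ h => ?_
  have hsub : (↑τ.support : Set α) ⊆ S := by simpa using h
  have := hS τ hτ
  rw [Set.inter_eq_left.2 hsub] at this
  obtain ⟨x, y, hxy, rfl⟩ := hl τ hτ
  exact hxy (this (by simpa using hxy.symm) (by simpa using hxy))

theorem supportCount_replicate {τ : Perm α} {S : Set α} (h : (↑τ.support : Set α) ⊆ S) (k : ℕ) :
    supportCount (List.replicate k τ) S = k := by
  simp [supportCount, List.countP_replicate, h]

/-- The invariants of a list of transpositions under standard moves agree on `l` and `l'`. -/
structure SameInvariants (l l' : List (Perm α)) : Prop where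
  prod_eq : l.prod = l'.prod
  closure_eq : Subgroup.closure {τ | τ ∈ l} = Subgroup.closure {τ | τ ∈ l'}
  supportCount_eq : ∀ x, supportCount l (MulAction.orbit (Subgroup.closure {τ | τ ∈ l}) x) =
    supportCount l' (MulAction.orbit (Subgroup.closure {τ | τ ∈ l}) x)

namespace SameInvariants

theorem symm {l l' : List (Perm α)} (h : SameInvariants l l') : SameInvariants l' l :=
  ⟨h.1.symm, h.2.symm, fun x => by rw [← h.2]; exact (h.3 x).symm⟩

theorem trans {l₁ l₂ l₃ : List (Perm α)} (h : SameInvariants l₁ l₂)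
    (h' : SameInvariants l₂ l₃) : SameInvariants l₁ l₃ :=
  ⟨h.1.trans h'.1, h.2.trans h'.2, fun x => (h.3 x).trans (by rw [h.2]; exact h'.3 x)⟩

end SameInvariants

theorem StdConnected.sameInvariants {l l' : List (Perm α)} (h : StdConnected l l') :
    SameInvariants l l' := by
  refine ⟨h.prod_eq, h.closure_eq, fun x => h.countP_eq _ fun g hg τ => ?_⟩
  refine decide_eq_decide.2 ?_
  set H := Subgroup.closure {a | a ∈ l}
  have hmem : ∀ z, g z ∈ MulAction.orbit H x ↔ z ∈ MulAction.orbit H x := fun z =>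
    ⟨fun h => by
      rw [← inv_smul_smul (⟨g, hg⟩ : H) z]
      exact MulAction.mem_orbit_of_mem_orbit _ h,
      MulAction.mem_orbit_of_mem_orbit (⟨g, hg⟩ : H)⟩
  rw [Perm.support_conj, Finset.coe_map, Set.image_subset_iff]
  exact forall₂_congr fun z _ => hmem z

theorem SameInvariants.of_append_replicate {n a : α} (ha : a ≠ n) {m m' : List (Perm α)}
    (hm : FixingSwaps n m) (hm' : FixingSwaps n m') {k : ℕ}
    (h : SameInvariants (m ++ List.replicate k (swap n a)) (m' ++ List.replicate k (swap n a))) :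
    SameInvariants m m' := by
  have hle : ∀ {m : List (Perm α)}, Subgroup.closure {τ | τ ∈ m} ≤
      Subgroup.closure {τ | τ ∈ m ++ List.replicate k (swap n a)} := fun {m} =>
    Subgroup.closure_mono fun τ hτ => List.mem_append_left _ hτ
  have key : ∀ {m m' : List (Perm α)}, FixingSwaps n m → FixingSwaps n m' →
      SameInvariants (m ++ List.replicate k (swap n a)) (m' ++ List.replicate k (swap n a)) →
      Subgroup.closure {τ | τ ∈ m} ≤ Subgroup.closure {τ | τ ∈ m'} := by
    intro m m' hm hm' h
    rw [Subgroup.closure_le]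
    intro τ hτ
    obtain ⟨⟨x, y, hxy, rfl⟩, hn⟩ := hm τ hτ
    have hx : x ≠ n := by rintro rfl; exact hxy (by rw [← hn, swap_apply_left])
    have hy : y ≠ n := by rintro rfl; exact hxy (by rw [← hn, swap_apply_right])
    refine swap_mem_closure_of_append_replicate ha hm' (k := k) hx hy ?_
    rw [← h.closure_eq]
    exact hle (Subgroup.subset_closure hτ)
  have hcl := le_antisymm (key hm hm' h) (key hm' hm h.symm)
  refine ⟨?_, hcl, fun x => ?_⟩
  · have := h.prod_eq
    rw [List.prod_append, List.prod_append] at this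
    exact mul_right_cancel this
  have hsw : ∀ τ ∈ m, τ.IsSwap := fun τ hτ => (hm τ hτ).1
  by_cases hx : x = n
  · subst hx
    have horb : MulAction.orbit (Subgroup.closure {τ | τ ∈ m}) x ⊆ {x} := by
      rintro _ ⟨g, rfl⟩
      exact hm.apply_eq g.2
    rw [supportCount_eq_zero hsw, supportCount_eq_zero fun τ hτ => (hm' τ hτ).1] <;>
      exact fun τ _ => Set.subsingleton_singleton.anti (Set.inter_subset_right.trans horb)
  have hcount := h.supportCount_eq x
  rw [supportCount_append, supportCount_append, Nat.add_right_cancel_iff] at hcount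
  have hcongr : ∀ m' : List (Perm α), FixingSwaps n m' →
      supportCount m' (MulAction.orbit (Subgroup.closure {τ | τ ∈ m}) x) =
      supportCount m' (MulAction.orbit
        (Subgroup.closure {τ | τ ∈ m ++ List.replicate k (swap n a)}) x) := by
    intro m' hm'
    rw [orbit_closure_eq_swap_mem hsw, orbit_closure_eq_swap_mem (hm.isSwap_append_replicate ha k)]
    refine supportCount_congr fun τ hτ => forall₂_congr fun z hz => ⟨fun h => hle h, fun h => ?_⟩
    refine swap_mem_closure_of_append_replicate ha hm ?_ hx h
    rintro rfl
    exact Perm.mem_support.1 hz (hm' τ hτ).2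
  rw [hcongr m hm, hcongr m' hm', hcount]

theorem SameInvariants.eq_of_isolated {n a a' : α} (ha : a ≠ n) (ha' : a' ≠ n)
    {m m' : List (Perm α)} (hm : FixingSwaps n m) (hm' : FixingSwaps n m') {k k' : ℕ}
    (hk : k ≠ 0) (hk' : k' ≠ 0)
    (h : SameInvariants (m ++ List.replicate k (swap n a))
      (m' ++ List.replicate k' (swap n a')))
    (hiso : ∀ τ ∈ m, τ a = a) : k = k' ∧ a = a' := by
  have hS : ∀ x, x ∈ MulAction.orbit
      (Subgroup.closure {τ | τ ∈ m ++ List.replicate k (swap n a)}) n ↔ x = n ∨ x = a := by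
    refine fun x => ⟨?_, ?_⟩
    · rintro ⟨⟨g, hg⟩, rfl⟩
      suffices ∀ z, z = n ∨ z = a → g z = n ∨ g z = a from this n (Or.inl rfl)
      induction hg using Subgroup.closure_induction'' with
      | mem τ hτ =>
        rcases List.mem_append.1 hτ with hτ | hτ
        · rintro z (hz | hz) <;> rw [hz]
          exacts [Or.inl (hm τ hτ).2, Or.inr (hiso τ hτ)]
        · rw [List.eq_of_mem_replicate hτ]
          rintro z (rfl | rfl) <;> simp
      | inv_mem τ hτ =>
        rcases List.mem_append.1 hτ with hτ | hτ
        · rintro z (hz | hz) <;> rw [hz]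
          exacts [Or.inl (Perm.inv_eq_iff_eq.2 (hm τ hτ).2.symm),
            Or.inr (Perm.inv_eq_iff_eq.2 (hiso τ hτ).symm)]
        · rw [List.eq_of_mem_replicate hτ]
          rintro z (rfl | rfl) <;> simp
      | one => exact fun z hz => hz
      | mul g g' _ _ hg hg' => exact fun z hz => hg _ (hg' z hz)
    · rintro (rfl | rfl)
      · exact MulAction.mem_orbit_self _
      · refine (swap_mem_closure_isSwap (hm.isSwap_append_replicate ha k)).1 ?_
        rw [swap_comm]
        exact swap_mem_closure_append_replicate hk
  have haa' : a = a' := by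
    refine (((hS a').1 ?_).resolve_left ha').symm
    rw [h.closure_eq]
    refine (swap_mem_closure_isSwap (hm'.isSwap_append_replicate ha' k')).1 ?_
    rw [swap_comm]
    exact swap_mem_closure_append_replicate hk'
  subst haa'
  refine ⟨?_, rfl⟩
  have hcount := h.supportCount_eq n
  have hzero : ∀ m' : List (Perm α), FixingSwaps n m' → supportCount m' (MulAction.orbit
      (Subgroup.closure {τ | τ ∈ m ++ List.replicate k (swap n a)}) n) = 0 := by
    intro m' hm'
    refine supportCount_eq_zero (fun τ hτ => (hm' τ hτ).1) fun τ hτ => ?_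
    refine (Set.subsingleton_singleton (a := a)).anti fun z hz => ?_
    refine ((hS z).1 hz.2).resolve_left ?_
    rintro rfl
    exact Perm.mem_support.1 hz.1 (hm' τ hτ).2
  have hsub : (↑(swap n a).support : Set α) ⊆ MulAction.orbit
      (Subgroup.closure {τ | τ ∈ m ++ List.replicate k (swap n a)}) n := by
    intro z hz
    rw [hS]
    exact (swap_apply_ne_self_iff.1 (Perm.mem_support.1 hz)).2
  rwa [supportCount_append, supportCount_append, hzero m hm, hzero m' hm',
    supportCount_replicate hsub, supportCount_replicate hsub, zero_add, zero_add] at hcount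

theorem SameInvariants.stdConnected {l l' : List (Perm α)} (hl : ∀ τ ∈ l, τ.IsSwap)
    (hl' : ∀ τ ∈ l', τ.IsSwap) (h : SameInvariants l l') : StdConnected l l' := by
  induction hN : l.length using Nat.strong_induction_on generalizing l l' with
  | _ N ih =>
  subst hN
  rcases l with _ | ⟨τ, t⟩
  · rcases l' with _ | ⟨τ, t⟩
    · exact StdConnected.refl _
    · have hmem : τ ∈ Subgroup.closure {τ' | τ' ∈ ([] : List (Perm α))} := by
        rw [h.closure_eq]
        exact Subgroup.subset_closure List.mem_cons_self
      obtain ⟨x, y, hxy, rfl⟩ := hl' τ List.mem_cons_self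
      have := Perm.apply_eq_of_mem_closure (x := x) (by simp) hmem
      rw [swap_apply_left] at this
      exact absurd this.symm hxy
  obtain ⟨n, b, hnb, hτ⟩ := hl τ List.mem_cons_self
  have hmem : swap n b ∈ Subgroup.closure {τ' | τ' ∈ τ :: t} :=
    Subgroup.subset_closure (by simp [hτ])
  have normal : ∀ l : List (Perm α), (∀ τ ∈ l, τ.IsSwap) →
      swap n b ∈ Subgroup.closure {τ' | τ' ∈ l} →
      ∃ m a k, a ≠ n ∧ k ≠ 0 ∧ FixingSwaps n m ∧ (k ≤ 2 ∨ ∀ τ ∈ m, τ a = a) ∧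
        StdConnected l (m ++ List.replicate k (swap n a)) := by
    intro l hl hmem
    obtain ⟨m₀, a₀, k₀, ha₀, hm₀, h₀⟩ := exists_stdConnected_append_replicate ⟨b, hnb.symm⟩ hl
    obtain ⟨m, a, k, ha, hm, hk, h₁⟩ := exists_stdConnected_reduced ha₀ hm₀ k₀
    have h := h₀.trans h₁
    rw [h.closure_eq] at hmem
    exact ⟨m, a, k, ha, hm.ne_zero_of_swap_mem_closure hnb.symm hmem, hm, hk, h⟩
  obtain ⟨m₁, a₁, k₁, ha₁, hk₁, hm₁, hr₁, h₁⟩ := normal _ hl hmem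
  rw [h.closure_eq] at hmem
  obtain ⟨m₂, a₂, k₂, ha₂, hk₂, hm₂, hr₂, h₂⟩ := normal _ hl' hmem
  have hinv := (h₁.sameInvariants.symm.trans h).trans h₂.sameInvariants
  suffices hs : StdConnected (m₂ ++ List.replicate k₂ (swap n a₂))
      (m₂ ++ List.replicate k₁ (swap n a₁)) by
    have hinv' := (hinv.trans hs.sameInvariants).of_append_replicate ha₁ hm₁ hm₂
    refine h₁.trans (StdConnected.trans ?_ (h₂.trans hs).symm)
    refine (ih m₁.length ?_ (fun τ hτ => (hm₁ τ hτ).1) (fun τ hτ => (hm₂ τ hτ).1) hinv'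
      rfl).append_right _
    have := h₁.length_eq
    rw [List.length_append, List.length_replicate] at this
    omega
  by_cases hbig : k₁ ≤ 2 ∧ k₂ ≤ 2
  · have hpar := hm₁.append_replicate_prod_inv_apply (a := a₁) k₁
    rw [hinv.prod_eq, hm₂.append_replicate_prod_inv_apply k₂] at hpar
    obtain rfl | rfl : k₁ = 1 ∨ k₁ = 2 := by omega
    · obtain rfl | rfl : k₂ = 1 ∨ k₂ = 2 := by omega
      · simp only [Nat.not_even_one, if_false] at hpar
        rw [hpar]
        exact StdConnected.refl _
      · simp only [even_two, Nat.not_even_one, if_true, if_false] at hpar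
        exact absurd hpar.symm ha₁
    · obtain rfl | rfl : k₂ = 1 ∨ k₂ = 2 := by omega
      · simp only [even_two, Nat.not_even_one, if_true, if_false] at hpar
        exact absurd hpar ha₂
      · refine StdConnected.of_append_replicate_two ha₁ ha₂ hm₂ ?_
        rw [← hinv.closure_eq]
        exact swap_mem_closure_append_replicate two_ne_zero
  · obtain ⟨rfl, rfl⟩ : k₁ = k₂ ∧ a₁ = a₂ := by
      rcases not_and_or.1 hbig with hb | hb
      · exact hinv.eq_of_isolated ha₁ ha₂ hm₁ hm₂ hk₁ hk₂ (hr₁.resolve_left hb)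
      · have := hinv.symm.eq_of_isolated ha₂ ha₁ hm₂ hm₁ hk₂ hk₁ (hr₂.resolve_left hb)
        exact ⟨this.1.symm, this.2.symm⟩
    exact StdConnected.refl _

end Perm

/-- Two lists of transpositions are connected by standard moves if and only if they have
the same product, generate the same subgroup `G`, and for every point `x` they have the
same number of entries supported in the `G`-orbit of `x`. -/
theorem stdConnected_iff_prod_closure_orbitCounts (n : ℕ)
    (l l' : List (Equiv.Perm (Fin n)))
    (hl : ∀ τ ∈ l, τ.IsSwap) (hl' : ∀ τ ∈ l', τ.IsSwap) :
    StdConnected l l' ↔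
      (l.prod = l'.prod ∧
        Subgroup.closure {τ | τ ∈ l} = Subgroup.closure {τ | τ ∈ l'} ∧
        ∀ x : Fin n,
          l.countP (fun τ => decide ((↑τ.support : Set (Fin n)) ⊆
              MulAction.orbit (Subgroup.closure {τ' | τ' ∈ l}) x)) =
          l'.countP (fun τ => decide ((↑τ.support : Set (Fin n)) ⊆
              MulAction.orbit (Subgroup.closure {τ' | τ' ∈ l}) x))) := by
  exact ⟨fun h => ⟨h.sameInvariants.1, h.sameInvariants.2, h.sameInvariants.3⟩,
    fun h => SameInvariants.stdConnected hl hl' ⟨h.1, h.2.1, h.2.2⟩⟩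
end

section
/- Let 1 ≤ r ≤ l ≤ k. Let (g₁,…,g_r) be a list of elements of FQ^k_l whose product g₁·g₂⋯g_r in the free group F_k equals the product x_0·x_1⋯x_{r−1} of the first r generators. Then the list (g₁,…,g_r) is connected by standard moves to the list (x_0, x_1, …, x_{r−1}). (Equivalently, the Artin action of the braid group Br_r is transitive on the set of decompositions of x_0⋯x_{r−1} as a product of r elements of FQ^k_l.) -/
/-- `FQ k l` is the subset of the free group on `k` generators consisting of `1` together
with the conjugacy classes of the first `l` generators. -/
def FQ (k l : ℕ) : Set (FreeGroup (Fin k)) :=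
  {1} ∪ {g | ∃ (w : FreeGroup (Fin k)) (i : Fin k), (i : ℕ) < l ∧ g = w⁻¹ * FreeGroup.of i * w}

theorem List.exists_eq_append_maximal_suffix {β : Type*} (U V : List β) :
    ∃ A B C : List β, U = A ++ C ∧ V = B ++ C ∧
      ∀ a ∈ A.getLast?, ∀ b ∈ B.getLast?, a ≠ b := by
  induction U using List.reverseRecOn generalizing V with
  | nil => exact ⟨[], V, [], by simp⟩
  | append_singleton U u ih =>
    rcases V.eq_nil_or_concat' with rfl | ⟨V, v, rfl⟩
    · exact ⟨U ++ [u], [], [], by simp⟩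
    · by_cases h : u = v
      · subst h
        obtain ⟨A, B, C, rfl, rfl, h⟩ := ih V
        exact ⟨A, B, C ++ [u], by simp, by simp, h⟩
      · exact ⟨U ++ [u], V ++ [v], [], by simp, by simp, by simpa using h⟩

theorem StandardMove.prod_eq {G : Type*} [Group G] {L L' : List G} (h : StandardMove L L') :
    L'.prod = L.prod := by
  obtain ⟨l₁, l₂, a, b, rfl, rfl | rfl⟩ := h <;> simp [mul_assoc]

namespace FreeGroup

variable {α : Type*}

/-- The conjugate `W⁻¹ * x_j * W` of a generator encoded by the pair `(W, j)`. -/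
def conjOf (p : List (α × Bool) × α) : FreeGroup α :=
  (mk p.1)⁻¹ * of p.2 * mk p.1

theorem prod_map_of (js : List α) :
    (js.map of).prod = mk (js.map fun j => (j, true)) := by
  induction js with
  | nil => rfl
  | cons j js ih => simp only [List.map_cons, List.prod_cons, ih, of, mul_mk, List.singleton_append]

theorem isReduced_map_true (js : List α) : IsReduced (js.map fun j => (j, true)) := by
  induction js with
  | nil => simp
  | cons j js ih =>
    refine List.isChain_cons.2 ⟨fun y hy _ => ?_, ih⟩
    have := List.mem_of_mem_head? hy
    grind

theorem IsReduced.eq_of_mk_eq {L₁ L₂ : List (α × Bool)} (h₁ : IsReduced L₁) (h₂ : IsReduced L₂)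
    (h : mk L₁ = mk L₂) : L₁ = L₂ := by
  classical
  rw [← h₁.reduce_eq, ← h₂.reduce_eq]
  exact reduce.sound h

theorem IsReduced.invRev {L : List (α × Bool)} (h : IsReduced L) :
    IsReduced (FreeGroup.invRev L) := by
  classical
  rw [isReduced_iff_reduce_eq, reduce_invRev, h.reduce_eq]

/-- Either the obvious word for a conjugate of a generator is reduced, or the conjugating word
can be shortened. -/
theorem isReduced_conj_or_exists_shorter (W : List (α × Bool)) (j : α) :
    IsReduced (invRev W ++ (j, true) :: W) ∨
      ∃ W' : List (α × Bool), W'.length < W.length ∧ conjOf (W', j) = conjOf (W, j) := by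
  classical
  by_cases hW : IsReduced W
  · rcases W with _ | ⟨⟨i, b⟩, W⟩
    · left; simp
    by_cases hij : i = j
    · subst hij
      right
      refine ⟨W, by simp, ?_⟩
      have : mk ((i, b) :: W) = mk [(i, b)] * mk W := by simp
      simp only [conjOf, this]
      have hc : (mk [(i, b)])⁻¹ * of i * mk [(i, b)] = of i := by
        cases b
        · have : mk [(i, false)] = (of i)⁻¹ := rfl
          rw [this]; group
        · have : mk [(i, true)] = of i := rfl
          rw [this]; group
      calc _ = (mk W)⁻¹ * ((mk [(i, b)])⁻¹ * of i * mk [(i, b)]) * mk W := by rw [hc]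
        _ = _ := by group
    · left
      refine List.isChain_append.2 ⟨hW.invRev, List.isChain_cons.2 ⟨?_, hW⟩, ?_⟩
      · simp; grind
      · simp [FreeGroup.invRev]; grind
  · right
    refine ⟨reduce W, lt_of_le_of_ne reduce.red.length_le fun h => hW ?_, ?_⟩
    · rw [isReduced_iff_reduce_eq]
      exact (reduce.red.sublist).eq_of_length h
    · simp [conjOf, reduce.self]

/-- The central letter of neither conjugate is cancelled in the product of two conjugates
of generators. -/
def CentersSurvive (p q : List (α × Bool) × α) : Prop :=
  (∀ X, q.1 ≠ X ++ (p.2, true) :: p.1) ∧ ∀ X, p.1 ≠ X ++ (q.2, false) :: q.1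

/-- If no central letter is cancelled, the product of the conjugates is at least as long as their
number, with equality only for trivial conjugating words. -/
theorem exists_isReduced_of_centersSurvive (p : List (α × Bool) × α)
    (S : List (List (α × Bool) × α))
    (hred : ∀ q ∈ p :: S, IsReduced (invRev q.1 ++ (q.2, true) :: q.1))
    (hchain : (p :: S).IsChain CentersSurvive) :
    ∃ T, IsReduced ((p.2, true) :: T) ∧
      mk p.1 * ((p :: S).map conjOf).prod = mk ((p.2, true) :: T) ∧
      S.length ≤ T.length ∧ (S.length = T.length → ∀ q ∈ p :: S, q.1 = []) := by
  induction S generalizing p with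
  | nil =>
    refine ⟨p.1, (List.isChain_append.1 (hred p (by simp))).2.1, ?_, by simp, ?_⟩
    · have : mk ((p.2, true) :: p.1) = of p.2 * mk p.1 := by simp [of]
      simp only [List.map_cons, List.map_nil, List.prod_singleton, conjOf, this]
      group
    · simpa using fun h : 0 = p.1.length => List.eq_nil_of_length_eq_zero h.symm
  | cons q S ih =>
    obtain ⟨hpq, hchain⟩ := List.isChain_cons_cons.1 hchain
    obtain ⟨T, hT, hprod, hle, heq⟩ := ih q (fun s hs => hred s (List.mem_cons_of_mem _ hs)) hchain
    have hp := (List.isChain_append.1 (hred p (by simp))).2.1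
    have hq := List.isChain_append.1 (hred q (by simp))
    obtain ⟨U, i⟩ := p
    obtain ⟨V, j⟩ := q
    obtain ⟨h1, h2⟩ := hpq
    obtain ⟨A, B, C, hU, hV, hAB⟩ := U.exists_eq_append_maximal_suffix V
    dsimp only at *
    refine ⟨A ++ (invRev B ++ (j, true) :: T), ?_, ?_, by simp; omega, ?_⟩
    · rw [← List.cons_append]
      refine List.isChain_append.2 ⟨?_, List.isChain_append.2 ⟨?_, hT, ?_⟩, ?_⟩
      · rw [hU, ← List.cons_append] at hp
        exact (List.isChain_append.1 hp).1
      · have := hq.1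
        rw [hV, invRev_append] at this
        exact (List.isChain_append.1 this).2.1
      · rcases B with _ | ⟨b, B⟩
        · simp
        · have := hq.2.2
          subst hV
          simpa [invRev] using this
      · rcases A.eq_nil_or_concat' with rfl | ⟨A, a, rfl⟩ <;>
          rcases B.eq_nil_or_concat' with rfl | ⟨B, b, rfl⟩
        · simp
        · have := h1 B
          obtain ⟨b, c⟩ := b
          simp [invRev]
          grind
        · have := h2 A
          obtain ⟨a, c⟩ := a
          rw [← List.cons_append, List.getLast?_append]
          simp
          grind
        · obtain ⟨a, c⟩ := a
          obtain ⟨b, d⟩ := b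
          rw [← List.cons_append, List.getLast?_append]
          simp only [List.getLast?_concat, Option.mem_def, Option.some.injEq, ne_eq,
            forall_eq'] at hAB
          simp [invRev]
          exact fun h => Bool.eq_not.2 fun hcd => hAB (Prod.ext h hcd)
    · have e1 : mk ((i, true) :: (A ++ (invRev B ++ (j, true) :: T))) =
          of i * mk A * (mk B)⁻¹ * mk ((j, true) :: T) := by
        simp [of, inv_mk, mul_mk]
      have e2 : mk U = mk A * mk C := by rw [hU, mul_mk]
      have e3 : mk V = mk B * mk C := by rw [hV, mul_mk]
      rw [e1, ← hprod, List.map_cons, List.prod_cons, conjOf, e3]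
      dsimp only
      rw [e2]
      group
    · intro h
      simp only [List.length_cons, List.length_append, invRev_length] at h
      have hnil := heq (by omega)
      have hA : A = [] := List.eq_nil_of_length_eq_zero (by omega)
      simp only [List.forall_mem_cons] at hnil ⊢
      refine ⟨?_, hnil⟩
      simp_all

theorem exists_conjOf_of_mem_FQ {k l : ℕ} {g : FreeGroup (Fin k)} (hg : g ∈ FQ k l) :
    g = 1 ∨ ∃ p, g = conjOf p := by
  rcases hg with h | ⟨w, i, -, h⟩
  · exact Or.inl h
  · exact Or.inr ⟨(w.toWord, i), by rw [conjOf, mk_toWord, h]⟩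

/-- The total exponent of an element of the free group. -/
def exponentSum : FreeGroup α →* Multiplicative ℤ :=
  lift fun _ => Multiplicative.ofAdd 1

theorem exponentSum_conjOf (p : List (α × Bool) × α) :
    exponentSum (conjOf p) = Multiplicative.ofAdd 1 := by
  rw [conjOf, _root_.map_mul, _root_.map_mul, _root_.map_inv, mul_right_comm, inv_mul_cancel,
    one_mul, exponentSum, lift_apply_of]

theorem toAdd_exponentSum_prod_map_of (js : List α) :
    (exponentSum (js.map of).prod).toAdd = js.length := by
  induction js with
  | nil => simp
  | cons j js ih =>
    rw [List.map_cons, List.prod_cons, _root_.map_mul, toAdd_mul, ih]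
    simp [exponentSum, add_comm]

/-- The exponent sum of a product of trivial elements and conjugates of generators is at most the
number of factors, with equality only if no factor is trivial. -/
theorem toAdd_exponentSum_prod_le (L : List (FreeGroup α))
    (hL : ∀ g ∈ L, g = 1 ∨ ∃ p, g = conjOf p) :
    (exponentSum L.prod).toAdd ≤ L.length ∧
      ((exponentSum L.prod).toAdd = L.length →
        ∃ S : List (List (α × Bool) × α), L = S.map conjOf) := by
  induction L with
  | nil => exact ⟨by simp, fun _ => ⟨[], rfl⟩⟩
  | cons g L ih =>
    obtain ⟨hle, heq⟩ := ih fun g hg => hL g (List.mem_cons_of_mem _ hg)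
    rw [List.prod_cons, _root_.map_mul, toAdd_mul, List.length_cons]
    rcases hL g (by simp) with rfl | ⟨p, rfl⟩
    · simp only [_root_.map_one, toAdd_one]
      push_cast
      exact ⟨by omega, fun h => by omega⟩
    · simp only [exponentSum_conjOf, toAdd_ofAdd]
      push_cast
      refine ⟨by omega, fun h => ?_⟩
      obtain ⟨S, rfl⟩ := heq (by omega)
      exact ⟨p :: S, rfl⟩

/-- If the central letter of one of two adjacent conjugates is cancelled in their product,
a standard move shortens the conjugating words. -/
theorem exists_standardMove_of_not_centersSurvive {p q : List (α × Bool) × α}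
    (h : ¬ CentersSurvive p q) (S₁ S₂ : List (List (α × Bool) × α)) :
    ∃ p' q' : List (α × Bool) × α, p'.1.length + q'.1.length < p.1.length + q.1.length ∧
      StandardMove ((S₁ ++ p :: q :: S₂).map conjOf) ((S₁ ++ p' :: q' :: S₂).map conjOf) := by
  obtain ⟨U, i⟩ := p
  obtain ⟨V, j⟩ := q
  simp only [CentersSurvive, not_and_or, not_forall, not_not] at h
  rcases h with ⟨X, rfl⟩ | ⟨X, rfl⟩
  · refine ⟨(X ++ U, j), (U, i), by simp; omega, S₁.map conjOf, S₂.map conjOf,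
      conjOf (U, i), conjOf (X ++ (i, true) :: U, j), by simp, Or.inr ?_⟩
    have e : mk (X ++ (i, true) :: U) = mk X * of i * mk U := by simp [of]
    have e' : mk (X ++ U) = mk X * mk U := by simp
    have : conjOf (X ++ U, j) =
        conjOf (U, i) * conjOf (X ++ (i, true) :: U, j) * (conjOf (U, i))⁻¹ := by
      simp only [conjOf, e, e']
      group
    simp [this]
  · refine ⟨(V, j), (X ++ V, i), by simp; omega, S₁.map conjOf, S₂.map conjOf,
      conjOf (X ++ (j, false) :: V, i), conjOf (V, j), by simp, Or.inl ?_⟩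
    have e : mk (X ++ (j, false) :: V) = mk X * (of j)⁻¹ * mk V := by simp [of, inv_mk, invRev]
    have e' : mk (X ++ V) = mk X * mk V := by simp
    have : conjOf (X ++ V, i) =
        (conjOf (V, j))⁻¹ * conjOf (X ++ (j, false) :: V, i) * conjOf (V, j) := by
      simp only [conjOf, e, e']
      group
    simp [this]

/-- A list of conjugates of generators without cancellation of central letters whose product is
a positive word of the same length consists of the letters of this word. -/
theorem map_conjOf_eq_of_centersSurvive {S : List (List (α × Bool) × α)} {js : List α}
    (hlen : S.length = js.length) (hprod : (S.map conjOf).prod = (js.map of).prod)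
    (hred : ∀ q ∈ S, IsReduced (invRev q.1 ++ (q.2, true) :: q.1))
    (hchain : S.IsChain CentersSurvive) : S.map conjOf = js.map of := by
  rcases S with _ | ⟨p, S⟩
  · simp [List.eq_nil_of_length_eq_zero hlen.symm]
  obtain ⟨T, hT, hmk, hle, heq⟩ := exists_isReduced_of_centersSurvive p S hred hchain
  have hp := List.isChain_append.1 (hred p (by simp))
  have hword : invRev p.1 ++ (p.2, true) :: T = js.map fun j => (j, true) := by
    refine IsReduced.eq_of_mk_eq (List.isChain_append.2 ⟨hp.1, hT, ?_⟩) (isReduced_map_true js) ?_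
    · simpa using hp.2.2
    · rw [← prod_map_of, ← hprod, ← mul_mk, ← hmk, ← inv_mk, inv_mul_cancel_left]
  have hl := congrArg List.length hword
  simp only [List.length_append, invRev_length, List.length_cons, List.length_map] at hl hlen
  have hnil := heq (by omega)
  have hmap : (p :: S).map conjOf = ((p :: S).map Prod.snd).map of := by
    rw [List.map_map]
    refine List.map_congr_left fun q hq => ?_
    simp [conjOf, hnil q hq, ← one_eq_mk]
  rw [hmap, prod_map_of, prod_map_of] at hprod
  have hw := (isReduced_map_true _).eq_of_mk_eq (isReduced_map_true _) hprod
  rw [hmap, List.map_injective_iff.2 (fun a b h => (Prod.mk.inj h).1) hw]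

theorem stdConnected_map_conjOf (S : List (List (α × Bool) × α)) (js : List α)
    (hlen : S.length = js.length) (hprod : (S.map conjOf).prod = (js.map of).prod) :
    StdConnected (S.map conjOf) (js.map of) := by
  induction hn : (S.map fun p => p.1.length).sum using Nat.strong_induction_on generalizing S with
  | _ n ih =>
    by_cases hred : ∀ q ∈ S, IsReduced (invRev q.1 ++ (q.2, true) :: q.1)
    · by_cases hchain : S.IsChain CentersSurvive
      · rw [map_conjOf_eq_of_centersSurvive hlen hprod hred hchain]
        exact Relation.ReflTransGen.refl
      · rw [List.isChain_iff_forall_rel_of_append_cons_cons] at hchain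
        push Not at hchain
        obtain ⟨p, q, S₁, S₂, rfl, hpq⟩ := hchain
        obtain ⟨p', q', hlt, hmove⟩ := exists_standardMove_of_not_centersSurvive hpq S₁ S₂
        refine .head hmove (ih _ ?_ _ (by simpa using hlen) (hmove.prod_eq.trans hprod) rfl)
        simp at hn ⊢
        omega
    · push Not at hred
      obtain ⟨⟨W, j⟩, hmem, hW⟩ := hred
      obtain ⟨W', hlt, hconj⟩ := (isReduced_conj_or_exists_shorter W j).resolve_left hW
      obtain ⟨S₁, S₂, rfl⟩ := List.append_of_mem hmem
      have hmap : (S₁ ++ (W', j) :: S₂).map conjOf = (S₁ ++ (W, j) :: S₂).map conjOf := by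
        simp [hconj]
      rw [← hmap] at hprod ⊢
      refine ih _ ?_ _ (by simpa using hlen) hprod rfl
      simp at hn ⊢
      omega

end FreeGroup

/-- Any decomposition of `x_0 ⋯ x_{r-1}` as a product of `r` elements of `FQ k l`
is connected by standard moves to the standard decomposition `(x_0, …, x_{r-1})`. -/
theorem stdConnected_decomposition_of_prod_of_generators
    (k l r : ℕ) (hr : 1 ≤ r) (hrl : r ≤ l) (hlk : l ≤ k)
    (L : List (FreeGroup (Fin k))) (hL : ∀ g ∈ L, g ∈ FQ k l)
    (hlen : L.length = r)
    (hprod : L.prod = ((List.finRange r).map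
      (fun i => FreeGroup.of (Fin.castLE (hrl.trans hlk) i))).prod) :
    StdConnected L ((List.finRange r).map
      (fun i => FreeGroup.of (Fin.castLE (hrl.trans hlk) i))) := by
  set js := (List.finRange r).map (Fin.castLE (hrl.trans hlk)) with hjs
  have hmap : (List.finRange r).map (fun i => FreeGroup.of (Fin.castLE (hrl.trans hlk) i)) =
      js.map FreeGroup.of := by simp [hjs]
  have hjlen : L.length = js.length := by simp [hjs, hlen]
  rw [hmap] at hprod ⊢
  obtain ⟨S, rfl⟩ := (FreeGroup.toAdd_exponentSum_prod_le L
    fun g hg => FreeGroup.exists_conjOf_of_mem_FQ (hL g hg)).2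
      (by rw [hprod, FreeGroup.toAdd_exponentSum_prod_map_of, hjlen])
  exact FreeGroup.stdConnected_map_conjOf S js (by simpa using hjlen) hprod
end

section
/- Let σ be a permutation of Fin n, let i ≠ i′ be elements of Fin n, and let τ = Equiv.swap i i′. If ¬ σ.SameCycle i i′ (i.e. i and i′ belong to different cycles of the cycle decomposition of σ, fixed points counting as cycles of length 1), then N(τ·σ) = N(σ) + 1; if σ.SameCycle i i′, then N(τ·σ) = N(σ) − 1. -/
namespace Equiv.Perm

section SameCycle

variable {α : Type*} [DecidableEq α] [Finite α] {σ : Perm α} {i j : α}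

theorem SameCycle.swap_mul_of_not (h : ¬ σ.SameCycle i j) :
    (swap i j * σ).SameCycle i j := by
  by_contra hρ
  set ρ := swap i j * σ with hρ_def
  have hσ : ∀ x, σ x = swap i j (ρ x) := fun x => by simp [hρ_def]
  have step : ∀ k : ℕ, (σ ^ k) i = (ρ ^ k) i → (ρ ^ (k + 1)) i ≠ i ∧
      (σ ^ (k + 1)) i = (ρ ^ (k + 1)) i := by
    intro k hk
    have hj : (ρ ^ (k + 1)) i ≠ j := fun e => hρ ⟨(k + 1 : ℕ), by simpa only [zpow_natCast] using e⟩
    have hs : (σ ^ (k + 1)) i = swap i j ((ρ ^ (k + 1)) i) := by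
      rw [pow_succ', mul_apply, hk, hσ, ← mul_apply ρ, ← pow_succ']
    have hi : (ρ ^ (k + 1)) i ≠ i := fun e =>
      h ⟨(k + 1 : ℕ), by rw [zpow_natCast, hs, e, swap_apply_left]⟩
    exact ⟨hi, hs.trans (swap_apply_of_ne_of_ne hi hj)⟩
  have key : ∀ k : ℕ, (σ ^ k) i = (ρ ^ k) i := fun k => by
    induction k with
    | zero => rfl
    | succ k ih => exact (step k ih).2
  obtain ⟨k, hk⟩ := Nat.exists_eq_succ_of_ne_zero (orderOf_pos ρ).ne'
  refine (step k (key k)).1 ?_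
  rw [← Nat.succ_eq_add_one, ← hk, pow_orderOf_eq_one, one_apply]

theorem SameCycle.not_swap_mul (hij : i ≠ j) (h : σ.SameCycle i j) :
    ¬ (swap i j * σ).SameCycle i j := by
  classical
  have hex : ∃ k : ℕ, (σ ^ k) i = j := h.exists_nat_pow_eq
  set k := Nat.find hex
  have hk : (σ ^ k) i = j := Nat.find_spec hex
  have hmin : ∀ m < k, (σ ^ m) i ≠ j := fun m hm => Nat.find_min hex hm
  have hk0 : 0 < k := Nat.pos_of_ne_zero fun h0 => hij (by simpa [h0] using hk)
  have inv : ∀ m : ℕ, ∃ l < k, ((swap i j * σ) ^ m) i = (σ ^ l) i := by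
    intro m
    induction m with
    | zero => exact ⟨0, hk0, Eq.refl _⟩
    | succ m ih =>
      obtain ⟨l, hl, e⟩ := ih
      have hs : ((swap i j * σ) ^ (m + 1)) i = swap i j ((σ ^ (l + 1)) i) := by
        rw [pow_succ', mul_apply, e, mul_apply, pow_succ' σ, mul_apply σ]
      obtain hlk | hlk := (Nat.succ_le_of_lt hl).eq_or_lt
      · refine ⟨0, hk0, ?_⟩
        rw [hs, ← Nat.succ_eq_add_one, hlk, hk, swap_apply_right, pow_zero, one_apply]
      · refine ⟨l + 1, hlk, hs.trans (swap_apply_of_ne_of_ne (fun hi => ?_) (hmin _ hlk))⟩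
        refine hmin (k - (l + 1)) (by omega) ?_
        rw [← hk]
        conv_rhs => rw [← Nat.sub_add_cancel hlk.le, pow_add, mul_apply]
        exact (congrArg _ hi).symm
  intro hρ
  obtain ⟨m, hm⟩ := hρ.exists_nat_pow_eq
  obtain ⟨l, hl, e⟩ := inv m
  exact hmin l hl (e.symm.trans hm)

end SameCycle

/-- The space of rational functions invariant under a permutation; its dimension is the number
of cycles, fixed points included. -/
def invariantFunctions {α : Type*} (σ : Perm α) : Submodule ℚ (α → ℚ) where
  carrier := {f | ∀ x, f (σ x) = f x}
  add_mem' hf hg x := by simp [hf x, hg x]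
  zero_mem' _ := rfl
  smul_mem' c f hf x := by simp [hf x]

section invariantFunctions

variable {α : Type*} {σ : Perm α} {i j : α}

theorem mem_invariantFunctions {f : α → ℚ} :
    f ∈ σ.invariantFunctions ↔ ∀ x, f (σ x) = f x := Iff.rfl

theorem finrank_invariantFunctions_one [Finite α] :
    Module.finrank ℚ (1 : Perm α).invariantFunctions = Nat.card α := by
  have := Fintype.ofFinite α
  have h : (1 : Perm α).invariantFunctions = ⊤ := eq_top_iff.2 fun _ _ _ => rfl
  rw [h, finrank_top, Module.finrank_fintype_fun_eq_card, Nat.card_eq_fintype_card]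

theorem SameCycle.apply_eq_of_mem_invariantFunctions [Finite α] (h : σ.SameCycle i j) {f : α → ℚ}
    (hf : f ∈ σ.invariantFunctions) : f i = f j := by
  obtain ⟨k, rfl⟩ := h.exists_nat_pow_eq
  induction k with
  | zero => rfl
  | succ k ih => rw [pow_succ', mul_apply, hf, ← ih ⟨k, by rw [zpow_natCast]⟩]

variable [DecidableEq α]

theorem mem_invariantFunctions_swap_mul {f : α → ℚ} (hf : f i = f j) :
    f ∈ (swap i j * σ).invariantFunctions ↔ f ∈ σ.invariantFunctions := by
  have : ∀ y, f (swap i j y) = f y := fun y => by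
    rw [swap_apply_def]; split_ifs <;> simp_all
  simp [mem_invariantFunctions, this]

variable [Finite α]

theorem finrank_invariantFunctions_swap_mul_of_not (h : ¬ σ.SameCycle i j) :
    Module.finrank ℚ (swap i j * σ).invariantFunctions + 1 =
      Module.finrank ℚ σ.invariantFunctions := by
  classical
  have := Fintype.ofFinite α
  let φ : (α → ℚ) →ₗ[ℚ] ℚ := (LinearMap.proj i : (α → ℚ) →ₗ[ℚ] ℚ) - LinearMap.proj j
  let ψ := φ.domRestrict σ.invariantFunctions
  have hker : (LinearMap.ker ψ).map σ.invariantFunctions.subtype =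
      (swap i j * σ).invariantFunctions := by
    ext f
    constructor
    · rintro ⟨g, hg, rfl⟩
      have : g.1 i = g.1 j := sub_eq_zero.1 hg
      exact (mem_invariantFunctions_swap_mul this).2 g.2
    · intro hf
      have e := (SameCycle.swap_mul_of_not h).apply_eq_of_mem_invariantFunctions hf
      exact ⟨⟨f, (mem_invariantFunctions_swap_mul e).1 hf⟩, sub_eq_zero.2 e, rfl⟩
  have hψ : ψ ≠ 0 := by
    intro h0
    have hg : (fun x => if σ.SameCycle i x then (1 : ℚ) else 0) ∈ σ.invariantFunctions :=
      fun x => by simp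
    have := LinearMap.congr_fun h0 ⟨_, hg⟩
    simp [ψ, φ, h, SameCycle.refl] at this
  have hrange : LinearMap.range ψ = ⊤ := LinearMap.range_eq_top.2 (LinearMap.surjective hψ)
  rw [← LinearMap.finrank_range_add_finrank_ker ψ, hrange, finrank_top, Module.finrank_self,
    ← hker, LinearEquiv.finrank_eq
      (Submodule.equivMapOfInjective _ σ.invariantFunctions.injective_subtype (LinearMap.ker ψ))]
  exact add_comm _ _

theorem finrank_invariantFunctions_swap_mul (hij : i ≠ j) (h : σ.SameCycle i j) :
    Module.finrank ℚ (swap i j * σ).invariantFunctions =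
      Module.finrank ℚ σ.invariantFunctions + 1 := by
  have := finrank_invariantFunctions_swap_mul_of_not (h.not_swap_mul hij)
  rw [swap_mul_self_mul] at this
  exact this.symm

theorem card_le_finrank_invariantFunctions_add_length (l : List (Perm α))
    (hl : ∀ τ ∈ l, τ.IsSwap) :
    Nat.card α ≤ Module.finrank ℚ l.prod.invariantFunctions + l.length := by
  induction l with
  | nil => rw [List.prod_nil, finrank_invariantFunctions_one, List.length_nil, add_zero]
  | cons τ l ih =>
    obtain ⟨⟨i, j, hij, rfl⟩, hl'⟩ := List.forall_mem_cons.1 hl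
    have := ih hl'
    rw [List.prod_cons, List.length_cons]
    by_cases h : l.prod.SameCycle i j
    · have := finrank_invariantFunctions_swap_mul hij h
      omega
    · have := finrank_invariantFunctions_swap_mul_of_not h
      omega

theorem exists_isSwap_list_length_add_finrank (σ : Perm α) :
    ∃ l : List (Perm α), (∀ τ ∈ l, τ.IsSwap) ∧ l.prod = σ ∧
      l.length + Module.finrank ℚ σ.invariantFunctions = Nat.card α := by
  have := Fintype.ofFinite α
  induction hd : Nat.card α - Module.finrank ℚ σ.invariantFunctions using Nat.strong_induction_on
    generalizing σ with
  | _ d ih =>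
    by_cases h1 : σ = 1
    · subst h1
      exact ⟨[], by simp, rfl, by simp [finrank_invariantFunctions_one]⟩
    obtain ⟨i, hi⟩ : ∃ i, σ i ≠ i := by
      by_contra! h
      exact h1 (ext h)
    have hr := finrank_invariantFunctions_swap_mul hi.symm
      (sameCycle_apply_right.2 (SameCycle.refl σ i))
    have hle := Submodule.finrank_le (swap i (σ i) * σ).invariantFunctions
    rw [Module.finrank_fintype_fun_eq_card, ← Nat.card_eq_fintype_card] at hle
    obtain ⟨l, hl, hprod, hlen⟩ := ih _ (by omega) (swap i (σ i) * σ) rfl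
    refine ⟨swap i (σ i) :: l, List.forall_mem_cons.2 ⟨⟨i, σ i, hi.symm, rfl⟩, hl⟩, ?_, ?_⟩
    · rw [List.prod_cons, hprod, swap_mul_self_mul]
    · rw [List.length_cons]
      omega

end invariantFunctions

end Equiv.Perm

theorem permNorm_add_finrank_invariantFunctions {n : ℕ} (σ : Equiv.Perm (Fin n)) :
    permNorm σ + Module.finrank ℚ σ.invariantFunctions = n := by
  obtain ⟨l, hl, hprod, hlen⟩ := σ.exists_isSwap_list_length_add_finrank
  have hle : permNorm σ ≤ l.length := Nat.sInf_le ⟨l, hl, hprod, rfl⟩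
  obtain ⟨l', hl', hprod', hlen'⟩ : permNorm σ ∈ {m | ∃ l : List (Equiv.Perm (Fin n)),
      (∀ τ ∈ l, τ.IsSwap) ∧ l.prod = σ ∧ l.length = m} :=
    Nat.sInf_mem ⟨_, l, hl, hprod, rfl⟩
  have hge := Equiv.Perm.card_le_finrank_invariantFunctions_add_length l' hl'
  rw [hprod', hlen'] at hge
  rw [Nat.card_fin] at hlen hge
  omega

/-- Multiplying by a transposition `swap i i'` raises the transposition norm by one if
`i` and `i'` lie in different cycles of `σ`, and lowers it by one otherwise. -/
theorem permNorm_swap_mul (n : ℕ) (σ : Equiv.Perm (Fin n)) (i i' : Fin n) (hii : i ≠ i') :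
    (¬ σ.SameCycle i i' → permNorm (Equiv.swap i i' * σ) = permNorm σ + 1) ∧
    (σ.SameCycle i i' → permNorm (Equiv.swap i i' * σ) = permNorm σ - 1) := by
  have hσ := permNorm_add_finrank_invariantFunctions σ
  have hρ := permNorm_add_finrank_invariantFunctions (Equiv.swap i i' * σ)
  constructor
  · intro h
    have := Equiv.Perm.finrank_invariantFunctions_swap_mul_of_not h
    omega
  · intro h
    have := Equiv.Perm.finrank_invariantFunctions_swap_mul hii h
    omega
end

section
/- Fix n ≥ 2 and let P be the group presented with one generator ⟨σ⟩ for every permutation σ of Fin n and relating words of(b)⁻¹ · of(a) · of(b) · of(b⁻¹·a·b)⁻¹ for all permutations a, b, together with of(a) · of(b) · of(a·b)⁻¹ for all permutations a, b with N(a·b) = N(a) + N(b). Then for any two transpositions τ, τ′ of Fin n, the images in P of the generators satisfy ⟨τ⟩² = ⟨τ′⟩², and this common element is central in P. -/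
/-- The conjugation relations, as identities between generators. -/
theorem conj_of_hurRels {n : ℕ} (a b : Equiv.Perm (Fin n)) :
    (PresentedGroup.of (rels := hurRels n) b)⁻¹ * PresentedGroup.of a * PresentedGroup.of b =
      PresentedGroup.of (b⁻¹ * a * b) := by
  have h := PresentedGroup.one_of_mem (rels := hurRels n) (Or.inl ⟨a, b, rfl⟩)
  simp only [map_mul, map_inv] at h
  exact mul_inv_eq_one.mp h

/-- The square of the generator of an involution is central. -/
theorem sq_of_mem_center_of_mul_self {n : ℕ} {b : Equiv.Perm (Fin n)} (hb : b * b = 1) :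
    (PresentedGroup.of (rels := hurRels n) b) ^ 2 ∈
      Subgroup.center (PresentedGroup (hurRels n)) := by
  have hcomm : ∀ a, PresentedGroup.of (rels := hurRels n) a ∈
      Subgroup.centralizer {(PresentedGroup.of (rels := hurRels n) b) ^ 2} := by
    intro a
    rw [Subgroup.mem_centralizer_singleton_iff]
    have h₁ := conj_of_hurRels a b
    have h₂ := conj_of_hurRels (b⁻¹ * a * b) b
    have hbb : b⁻¹ * (b⁻¹ * a * b) * b = a := by
      rw [inv_eq_of_mul_eq_one_left hb]
      calc b * (b * a * b) * b = (b * b) * a * (b * b) := by group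
        _ = a := by rw [hb, one_mul, mul_one]
    rw [hbb, ← h₁] at h₂
    calc PresentedGroup.of a * PresentedGroup.of b ^ 2
        = PresentedGroup.of b ^ 2 * ((PresentedGroup.of b)⁻¹ *
          ((PresentedGroup.of b)⁻¹ * PresentedGroup.of a * PresentedGroup.of b) *
            PresentedGroup.of b) := by rw [sq]; group
      _ = PresentedGroup.of b ^ 2 * PresentedGroup.of a := by rw [h₂]
  rw [Subgroup.mem_center_iff]
  intro g
  have hg : g ∈ Subgroup.closure (Set.range (PresentedGroup.of (rels := hurRels n))) := by
    simp
  have hle := (Subgroup.closure_le _).mpr (Set.range_subset_iff.mpr hcomm)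
  exact Subgroup.mem_centralizer_singleton_iff.mp (hle hg)

/-- In the enveloping group of `S_n^geo`, the squares of the classes of any two
transpositions agree, and this common element is central. -/
theorem sq_of_transpositions_eq_and_central (n : ℕ) (hn : 2 ≤ n)
    (τ τ' : Equiv.Perm (Fin n)) (hτ : τ.IsSwap) (hτ' : τ'.IsSwap) :
    (PresentedGroup.of (rels := hurRels n) τ) ^ 2 =
      (PresentedGroup.of (rels := hurRels n) τ') ^ 2 ∧
    (PresentedGroup.of (rels := hurRels n) τ) ^ 2 ∈
      Subgroup.center (PresentedGroup (hurRels n)) := by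
  have hc : (PresentedGroup.of (rels := hurRels n) τ) ^ 2 ∈
      Subgroup.center (PresentedGroup (hurRels n)) := by
    obtain ⟨x, y, -, rfl⟩ := hτ
    exact sq_of_mem_center_of_mul_self (Equiv.swap_mul_self x y)
  refine ⟨?_, hc⟩
  have hconj : IsConj τ' τ := by
    obtain ⟨x, y, hxy, rfl⟩ := hτ
    obtain ⟨z, w, hzw, rfl⟩ := hτ'
    exact Equiv.Perm.isConj_swap hzw hxy
  obtain ⟨c, rfl⟩ := isConj_iff.mp hconj
  have h := conj_of_hurRels (c * τ' * c⁻¹) c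
  rw [show c⁻¹ * (c * τ' * c⁻¹) * c = τ' by group] at h
  have hcomm := Subgroup.mem_center_iff.mp hc (PresentedGroup.of c)
  rw [← h]
  generalize PresentedGroup.of (rels := hurRels n) (c * τ' * c⁻¹) = t at hcomm ⊢
  generalize PresentedGroup.of (rels := hurRels n) c = g at hcomm ⊢
  calc t ^ 2 = g⁻¹ * (g * t ^ 2) := by group
    _ = (g⁻¹ * t * g) ^ 2 := by rw [hcomm, sq, sq]; group
end

section
/- Let n ≥ 2. The subgroup of the product group ℤ × Equiv.Perm (Fin n) consisting of all pairs (r, σ) with (−1)^r = sign σ is generated by the set {(1, τ) : τ a transposition of Fin n}. -/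
/-- For `n ≥ 2`, the parity subgroup of `ℤ × S_n` is generated by the elements `(1, τ)`
for `τ` a transposition. -/
theorem paritySubgroup_eq_closure_of_transpositions (n : ℕ) (hn : 2 ≤ n) :
    Subgroup.closure {p : Multiplicative ℤ × Equiv.Perm (Fin n) |
        p.1 = Multiplicative.ofAdd (1 : ℤ) ∧ p.2.IsSwap} =
      paritySubgroup n := by
  apply le_antisymm
  · rw [Subgroup.closure_le]
    rintro ⟨r, σ⟩ ⟨hr, hσ⟩
    change (-1 : ℤˣ) ^ (Multiplicative.toAdd r) = Equiv.Perm.sign σ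
    rw [show r = Multiplicative.ofAdd 1 from hr, Equiv.Perm.IsSwap.sign_eq hσ]
    simp
  · rintro ⟨r, σ⟩ h
    change (-1 : ℤˣ) ^ (Multiplicative.toAdd r) = Equiv.Perm.sign σ at h
    induction σ using Equiv.Perm.swap_induction_on generalizing r with
    | one =>
      have hr : Even (Multiplicative.toAdd r) := by
        by_contra hodd
        rw [(Int.not_even_iff_odd.mp hodd).neg_one_zpow, map_one] at h
        exact absurd h (by decide)
      obtain ⟨k, hk⟩ := hr
      have hne : (⟨0, by lia⟩ : Fin n) ≠ ⟨1, by lia⟩ := by simp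
      let τ : Equiv.Perm (Fin n) := Equiv.swap ⟨0, by lia⟩ ⟨1, by lia⟩
      have heq : (r, (1 : Equiv.Perm (Fin n))) = (Multiplicative.ofAdd (1 : ℤ), τ) ^ (k + k) := by
        refine Prod.ext ?_ ?_
        · apply Multiplicative.toAdd.injective
          simp [hk]
        · change 1 = τ ^ (k + k)
          rw [zpow_add, ← (Commute.refl τ).mul_zpow, Equiv.swap_mul_self, one_zpow]
      rw [heq]
      refine Subgroup.zpow_mem _ (Subgroup.subset_closure ?_) _
      exact ⟨rfl, _, _, hne, rfl⟩
    | swap_mul f x y hxy ih =>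
      have heq : (r, Equiv.swap x y * f) = (Multiplicative.ofAdd (1 : ℤ), Equiv.swap x y) *
          (Multiplicative.ofAdd (Multiplicative.toAdd r - 1), f) := by
        refine Prod.ext ?_ rfl
        apply Multiplicative.toAdd.injective
        simp
      rw [heq]
      refine Subgroup.mul_mem _ (Subgroup.subset_closure ?_) (ih _ ?_)
      · exact ⟨rfl, x, y, hxy, rfl⟩
      · rw [toAdd_ofAdd, zpow_sub, h, Equiv.Perm.sign_mul, Equiv.Perm.sign_swap hxy]
        simp
end

section
/- Let 0 ≤ l ≤ k and let L and L′ be two lists of non-identity elements of FQ^k_l whose products in the free group F_k are equal. Then L and L′ have the same length. (The number of factors in any decomposition of an element of F_k as a product of non-identity elements of FQ^k_l depends only on the element, and equals the sum of the entries of its image in the abelianization ℤ^k.) -/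
/-- The homomorphism from a free group to `ℤ` sending every generator to `1`. -/
def FreeGroup.exponentSum_s15 (α : Type*) : FreeGroup α →* Multiplicative ℤ :=
  FreeGroup.lift fun _ => Multiplicative.ofAdd 1

theorem FreeGroup.exponentSum_of_mem_FQ {k l : ℕ} {g : FreeGroup (Fin k)}
    (hg : g ∈ FQ k l) (hg1 : g ≠ 1) :
    FreeGroup.exponentSum_s15 (Fin k) g = Multiplicative.ofAdd 1 := by
  obtain rfl | ⟨w, i, -, rfl⟩ := hg
  · exact absurd rfl hg1
  · simp [FreeGroup.exponentSum_s15, mul_comm]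

/-- The number of non-identity factors from `FQ k l` is the exponent sum of the product. -/
theorem FreeGroup.exponentSum_prod_of_mem_FQ {k l : ℕ} (L : List (FreeGroup (Fin k)))
    (hL : ∀ g ∈ L, g ∈ FQ k l ∧ g ≠ 1) :
    FreeGroup.exponentSum_s15 (Fin k) L.prod = Multiplicative.ofAdd (L.length : ℤ) := by
  rw [map_list_prod, List.prod_eq_pow_card _ (Multiplicative.ofAdd (1 : ℤ)), ← ofAdd_nsmul]
  · simp
  · simp only [List.mem_map, forall_exists_index, and_imp, forall_apply_eq_imp_iff₂]
    exact fun g hg => exponentSum_of_mem_FQ (hL g hg).1 (hL g hg).2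

/-- Two lists of non-identity elements of `FQ k l` with the same product in the free
group have the same length. -/
theorem length_eq_of_prod_eq_of_mem_FQ (k l : ℕ) (hlk : l ≤ k)
    (L L' : List (FreeGroup (Fin k)))
    (hL : ∀ g ∈ L, g ∈ FQ k l ∧ g ≠ 1)
    (hL' : ∀ g ∈ L', g ∈ FQ k l ∧ g ≠ 1)
    (hprod : L.prod = L'.prod) :
    L.length = L'.length := by
  have h := congrArg (FreeGroup.exponentSum_s15 (Fin k)) hprod
  rw [FreeGroup.exponentSum_prod_of_mem_FQ L hL, FreeGroup.exponentSum_prod_of_mem_FQ L' hL'] at h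
  exact_mod_cast Multiplicative.ofAdd.injective h
end
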